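/- arXiv:2103.05725 — 4 statements merged into one kernel-verified Lean document; each statement's English description precedes it below -/
import Mathlib

section
/- Suppose X is a first countable Hausdorff topological space with |X| ≤ 𝔠. Then X is 2^ω-partitionable if and only if X is 2^ω-coverable. -/
open Cardinal Set TopologicalSpace

/-- The Cantor space `2^ω`. -/
abbrev CantorSpace : Type := ℕ → Bool

/-- `X` is `Y`-coverable: there is a family of subspaces of `X`, each homeomorphic to `Y`,
whose union is `X`. -/
def Coverable (X Y : Type*) [TopologicalSpace X] [TopologicalSpace Y] : Prop :=
  ∃ C : Set (Set X), (∀ K ∈ C, Nonempty (K ≃ₜ Y)) ∧ ⋃₀ C = Set.univ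

/-- `X` is `Y`-partitionable: there is a partition of `X` into pairwise disjoint subspaces,
each homeomorphic to `Y`. -/
def Partitionable (X Y : Type*) [TopologicalSpace X] [TopologicalSpace Y] : Prop :=
  ∃ P : Set (Set X), (∀ K ∈ P, Nonempty (K ≃ₜ Y)) ∧ P.PairwiseDisjoint id ∧ ⋃₀ P = Set.univ

/-- A packing of copies of `Y` into `X`: a pairwise disjoint family of subspaces of `X`,
each homeomorphic to `Y`. -/
def IsPacking {X : Type*} [TopologicalSpace X] (Y : Type*) [TopologicalSpace Y]
    (Q : Set (Set X)) : Prop :=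
  (∀ K ∈ Q, Nonempty (K ≃ₜ Y)) ∧ Q.PairwiseDisjoint id

/-- The point of the Cantor space that agrees with `p` below `n` and repeats every bit of `v`
infinitely often from `n` on. -/
def cantorPad (n : ℕ) (p v : CantorSpace) : CantorSpace :=
  fun k => if k < n then p k else v (Nat.unpair k).1

/-- Interleaving of two points of the Cantor space. -/
def cantorMerge (y w : CantorSpace) : CantorSpace :=
  fun j => if j % 2 = 0 then y (j / 2) else w (j / 2)

lemma cantorPad_eq {n n' : ℕ} {p p' v v' : CantorSpace}
    (h : cantorPad n p v = cantorPad n' p' v') : v = v' := by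
  funext j
  have h1 := congrFun h (Nat.pair j (n + n'))
  have h2 := Nat.right_le_pair j (n + n')
  have h3 : ¬ Nat.pair j (n + n') < n := by omega
  have h4 : ¬ Nat.pair j (n + n') < n' := by omega
  simpa [cantorPad, h3, h4] using h1

lemma cantorMerge_eq {y y' w w' : CantorSpace}
    (h : cantorMerge y w = cantorMerge y' w') : y = y' ∧ w = w' := by
  constructor
  · funext j
    simpa [cantorMerge] using congrFun h (2 * j)
  · funext j
    have h1 : (2 * j + 1) / 2 = j := by omega
    simpa [cantorMerge, h1, Nat.add_mod] using congrFun h (2 * j + 1)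

lemma continuous_cantorPad (n : ℕ) (p : CantorSpace) : Continuous (cantorPad n p) := by
  refine continuous_pi fun k => ?_
  by_cases h : k < n
  · simpa [cantorPad, h] using continuous_const
  · simpa [cantorPad, h] using continuous_apply _

lemma continuous_cantorMerge (y : CantorSpace) : Continuous (cantorMerge y) := by
  refine continuous_pi fun k => ?_
  by_cases h : k % 2 = 0
  · simpa [cantorMerge, h] using continuous_const
  · simpa [cantorMerge, h] using continuous_apply _

lemma exists_cantorPad_mem {U : Set CantorSpace} (hU : IsOpen U) {z : CantorSpace} (hz : z ∈ U) :
    ∃ n, ∀ v, cantorPad n z v ∈ U := by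
  obtain ⟨I, u, hu, hsub⟩ := isOpen_pi_iff.1 hU z hz
  refine ⟨I.sup id + 1, fun v => hsub fun k hk => ?_⟩
  have h : k < I.sup id + 1 := Nat.lt_succ_of_le (Finset.le_sup (f := id) hk)
  simpa [cantorPad, h] using (hu k hk).2

lemma nonempty_homeomorph_cantorSpace_iff {X : Type*} [TopologicalSpace X] [T2Space X]
    {K : Set X} : Nonempty (K ≃ₜ CantorSpace) ↔
      ∃ f : CantorSpace → X, Continuous f ∧ Function.Injective f ∧ range f = K := by
  constructor
  · rintro ⟨e⟩
    refine ⟨fun z => (e.symm z : X), continuous_subtype_val.comp e.symm.continuous,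
      Subtype.val_injective.comp e.symm.injective, ?_⟩
    ext x
    constructor
    · rintro ⟨z, rfl⟩
      exact (e.symm z).2
    · exact fun hx => ⟨e ⟨x, hx⟩, by simp⟩
  · rintro ⟨f, hf, hi, rfl⟩
    exact ⟨(hf.isClosedEmbedding hi).isEmbedding.toHomeomorph.symm⟩

lemma exists_maximal_isPacking (X Y : Type*) [TopologicalSpace X] [TopologicalSpace Y] :
    ∃ Q : Set (Set X), Maximal (IsPacking Y) Q := by
  refine zorn_subset {Q | IsPacking Y Q} fun c hc hchain =>
    ⟨⋃₀ c, ⟨?_, ?_⟩, fun s hs => subset_sUnion_of_mem hs⟩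
  · rintro K ⟨Q, hQ, hK⟩
    exact (hc hQ).1 K hK
  · exact (pairwiseDisjoint_sUnion hchain.directedOn).2 fun Q hQ => (hc hQ).2

/-- In a space covered by Cantor sets, the members of a maximal packing meet every nonempty
open set. -/
lemma exists_mem_inter_nonempty_of_maximal {X : Type*} [TopologicalSpace X] [T2Space X]
    (hX : Coverable X CantorSpace) {Q : Set (Set X)} (hQ : Maximal (IsPacking CantorSpace) Q)
    {U : Set X} (hU : IsOpen U) {x : X} (hx : x ∈ U) : ∃ K ∈ Q, (K ∩ U).Nonempty := by
  obtain ⟨C, hC, hcov⟩ := hX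
  obtain ⟨K, hK, hxK⟩ : x ∈ ⋃₀ C := hcov ▸ mem_univ x
  obtain ⟨f, hf, hi, rfl⟩ := nonempty_homeomorph_cantorSpace_iff.1 (hC K hK)
  obtain ⟨z, rfl⟩ := hxK
  obtain ⟨n, hn⟩ := exists_cantorPad_mem (hU.preimage hf) hx
  by_contra! hcon
  set D : Set X := range fun v => f (cantorPad n z v) with hD
  have hdisj : ∀ K ∈ Q, Disjoint D K := by
    rintro K hK
    rw [Set.disjoint_left]
    rintro _ ⟨v, rfl⟩ hv
    exact (hcon K hK).subset ⟨hv, hn v⟩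
  have hpack : IsPacking CantorSpace (insert D Q) := by
    refine ⟨?_, hQ.1.2.insert fun K hK _ => hdisj K hK⟩
    rintro K (rfl | hK)
    · exact nonempty_homeomorph_cantorSpace_iff.2
        ⟨_, hf.comp (continuous_cantorPad n z), fun v w h => cantorPad_eq (hi h), rfl⟩
    · exact hQ.1.1 K hK
  have hmem : D ∈ Q := hQ.2 hpack (subset_insert _ _) (mem_insert _ _)
  exact Set.disjoint_left.1 (hdisj D hmem) (mem_range_self z) (mem_range_self z)

/-- Gluing a sequence of maps from the Cantor space to a point: sequences starting with
exactly `m` zeros are mapped by the `m`-th map. -/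
noncomputable def cantorGlue {X : Type*} (x : X) (h : ℕ → CantorSpace → X) (z : CantorSpace) : X :=
  open Classical in
  if hz : ∃ k, z k = true then h (Nat.find hz) (fun j => z (Nat.find hz + 1 + j)) else x

lemma cantorGlue_of_first {X : Type*} (x : X) (h : ℕ → CantorSpace → X) {z : CantorSpace} {m : ℕ}
    (hm : z m = true) (hlt : ∀ k < m, z k = false) :
    cantorGlue x h z = h m (fun j => z (m + 1 + j)) := by
  classical
  have hz : ∃ k, z k = true := ⟨m, hm⟩
  have hfind : Nat.find hz = m := (Nat.find_eq_iff hz).2 ⟨hm, fun k hk => by simp [hlt k hk]⟩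
  unfold cantorGlue
  rw [dif_pos hz]
  convert rfl using 2 <;> simp [← hfind]

lemma cantorGlue_zero {X : Type*} (x : X) (h : ℕ → CantorSpace → X) :
    cantorGlue x h (fun _ => false) = x := by
  simp [cantorGlue]

lemma cantorSpace_eq_zero_or (z : CantorSpace) :
    z = (fun _ => false) ∨ ∃ m, z m = true ∧ ∀ k < m, z k = false := by
  classical
  by_cases hz : ∃ k, z k = true
  · exact Or.inr ⟨Nat.find hz, Nat.find_spec hz, fun k hk => by simpa using Nat.find_min hz hk⟩
  · left
    funext k
    simpa using fun h => hz ⟨k, h⟩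

lemma range_cantorGlue {X : Type*} (x : X) (h : ℕ → CantorSpace → X) :
    range (cantorGlue x h) = insert x (⋃ m, range (h m)) := by
  ext y
  constructor
  · rintro ⟨z, rfl⟩
    rcases cantorSpace_eq_zero_or z with rfl | ⟨m, hm, hlt⟩
    · exact Or.inl (cantorGlue_zero x h)
    · rw [cantorGlue_of_first x h hm hlt]
      exact Or.inr (mem_iUnion.2 ⟨m, mem_range_self _⟩)
  · rintro (rfl | hy)
    · exact ⟨_, cantorGlue_zero y h⟩
    · obtain ⟨m, w, rfl⟩ := mem_iUnion.1 hy
      refine ⟨fun k => if k < m then false else if k = m then true else w (k - (m + 1)), ?_⟩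
      rw [cantorGlue_of_first x h (m := m) (by simp) (fun k hk => by simp [hk])]
      congr 1
      funext j
      have h1 : ¬ m + 1 + j < m := by omega
      have h2 : ¬ m + 1 + j = m := by omega
      simp [h1, h2]

lemma injective_cantorGlue {X : Type*} {x : X} {h : ℕ → CantorSpace → X}
    (hi : ∀ m, Function.Injective (h m)) (hd : ∀ m n w w', h m w = h n w' → m = n)
    (hx : ∀ m w, h m w ≠ x) : Function.Injective (cantorGlue x h) := by
  intro z z' hzz
  rcases cantorSpace_eq_zero_or z with rfl | ⟨m, hm, hlt⟩ <;>
    rcases cantorSpace_eq_zero_or z' with rfl | ⟨m', hm', hlt'⟩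
  · rfl
  · rw [cantorGlue_zero, cantorGlue_of_first x h hm' hlt'] at hzz
    exact absurd hzz.symm (hx _ _)
  · rw [cantorGlue_zero, cantorGlue_of_first x h hm hlt] at hzz
    exact absurd hzz (hx _ _)
  · rw [cantorGlue_of_first x h hm hlt, cantorGlue_of_first x h hm' hlt'] at hzz
    obtain rfl := hd _ _ _ _ hzz
    have htail := hi m hzz
    funext k
    rcases lt_trichotomy k m with hk | rfl | hk
    · rw [hlt k hk, hlt' k hk]
    · rw [hm, hm']
    · have := congrFun htail (k - (m + 1))
      simpa [show m + 1 + (k - (m + 1)) = k by omega] using this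

lemma continuous_cantorGlue {X : Type*} [TopologicalSpace X] {x : X} {h : ℕ → CantorSpace → X}
    (hc : ∀ m, Continuous (h m)) {U : ℕ → Set X} (hU : (nhds x).HasAntitoneBasis U)
    (hhU : ∀ m w, h m w ∈ U m) : Continuous (cantorGlue x h) := by
  have hcyl : ∀ (z : CantorSpace) (m : ℕ), ∀ᶠ z' in nhds z, ∀ k < m, z' k = z k := by
    intro z m
    refine (Filter.eventually_all_finite (Set.finite_lt_nat m)).2 fun k _ => ?_
    have hopen : IsOpen {z' : CantorSpace | z' k = z k} :=
      (isOpen_discrete ({z k} : Set Bool)).preimage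
        (continuous_apply k : Continuous fun z' : CantorSpace => z' k)
    exact hopen.mem_nhds rfl
  refine continuous_iff_continuousAt.2 fun z => ?_
  rcases cantorSpace_eq_zero_or z with rfl | ⟨m, hm, hlt⟩
  · rw [ContinuousAt, cantorGlue_zero, hU.toHasBasis.tendsto_right_iff]
    intro m _
    filter_upwards [hcyl _ m] with z' hz'
    rcases cantorSpace_eq_zero_or z' with rfl | ⟨k, hk, hlt⟩
    · rw [cantorGlue_zero]
      exact mem_of_mem_nhds (hU.mem m)
    · rw [cantorGlue_of_first x h hk hlt]
      have hmk : m ≤ k := by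
        by_contra! hcon
        simp [hz' k hcon] at hk
      exact hU.antitone hmk (hhU k _)
  · have heq : cantorGlue x h =ᶠ[nhds z] fun z' => h m (fun j => z' (m + 1 + j)) := by
      filter_upwards [hcyl z (m + 1)] with z' hz'
      exact cantorGlue_of_first x h (by rw [hz' m (by omega), hm])
        fun k hk => by rw [hz' k (by omega), hlt k hk]
    refine ContinuousAt.congr ?_ heq.symm
    exact ((hc m).comp (continuous_pi fun j => continuous_apply _)).continuousAt

lemma exists_injective_prod_nat_cantorSpace {X : Type*} (hX : Cardinal.mk X ≤ Cardinal.continuum) :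
    ∃ e : X × ℕ → CantorSpace, Function.Injective e := by
  have h : Cardinal.lift.{0} (Cardinal.mk (X × ℕ)) ≤
      Cardinal.lift (Cardinal.mk CantorSpace) := by
    have h2 : Cardinal.mk CantorSpace = Cardinal.continuum := by simp
    rw [h2, Cardinal.lift_continuum, Cardinal.lift_uzero, Cardinal.mk_prod]
    simpa using (mul_le_mul_left hX Cardinal.aleph0).trans Cardinal.continuum_mul_aleph0.le
  obtain ⟨e⟩ := Cardinal.lift_mk_le'.1 h
  exact ⟨e, e.injective⟩

/-- Disjoint Cantor sets can be chosen simultaneously inside all members of a neighbourhood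
assignment of size at most continuum. -/
lemma exists_disjoint_cantor_maps {X : Type*} [TopologicalSpace X] [T2Space X]
    (hX : Cardinal.mk X ≤ Cardinal.continuum) (hcov : Coverable X CantorSpace)
    (U : X → ℕ → Set X) (hU : ∀ x m, U x m ∈ nhds x) :
    ∃ h : X → ℕ → CantorSpace → X, (∀ x m, Continuous (h x m)) ∧
      (∀ x m, Function.Injective (h x m)) ∧ (∀ x m w, h x m w ∈ U x m) ∧
      ∀ x m w x' m' w', h x m w = h x' m' w' → x = x' ∧ m = m' := by
  obtain ⟨e, he⟩ := exists_injective_prod_nat_cantorSpace hX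
  obtain ⟨Q, hQ⟩ := exists_maximal_isPacking X CantorSpace
  have hparam : ∀ K : Q, ∃ f : CantorSpace → X,
      Continuous f ∧ Function.Injective f ∧ range f = K :=
    fun K => nonempty_homeomorph_cantorSpace_iff.1 (hQ.1.1 K K.2)
  choose f hf hi hr using hparam
  have hex : ∀ x m, ∃ (K : Q) (n : ℕ) (p : CantorSpace), ∀ v, f K (cantorPad n p v) ∈ U x m := by
    intro x m
    obtain ⟨K, hK, y, hyK, hyU⟩ := exists_mem_inter_nonempty_of_maximal hcov hQ
      isOpen_interior (mem_interior_iff_mem_nhds.2 (hU x m))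
    obtain ⟨z, rfl⟩ : y ∈ range (f ⟨K, hK⟩) := (hr ⟨K, hK⟩).symm ▸ hyK
    obtain ⟨n, hn⟩ := exists_cantorPad_mem (isOpen_interior.preimage (hf ⟨K, hK⟩)) hyU
    exact ⟨⟨K, hK⟩, n, z, fun v => interior_subset (hn v)⟩
  choose K n p hKnp using hex
  refine ⟨fun x m w => f (K x m) (cantorPad (n x m) (p x m) (cantorMerge (e (x, m)) w)),
    fun x m => (hf _).comp ((continuous_cantorPad _ _).comp (continuous_cantorMerge _)),
    fun x m w w' h => (cantorMerge_eq (cantorPad_eq (hi _ h))).2, fun x m w => hKnp x m _, ?_⟩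
  intro x m w x' m' w' h
  have hKK : K x m = K x' m' := by
    by_contra hne
    have hmem : ∀ (L : Q) v, f L v ∈ (L : Set X) := fun L v => (hr L).subset (mem_range_self v)
    have hdisj : Disjoint (K x m : Set X) (K x' m') :=
      hQ.1.2 (K x m).2 (K x' m').2 fun h => hne (Subtype.ext h)
    exact Set.disjoint_left.1 hdisj (hmem _ _) (Set.mem_of_eq_of_mem h (hmem _ _))
  simp only [hKK] at h
  simpa using he (cantorMerge_eq (cantorPad_eq (hi _ h))).1

theorem stmt_3 {X : Type*} [TopologicalSpace X] [T2Space X] [FirstCountableTopology X]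
    (hX : Cardinal.mk X ≤ Cardinal.continuum) :
    Partitionable X CantorSpace ↔ Coverable X CantorSpace := by
  refine ⟨fun ⟨P, hP, _, hcov⟩ => ⟨P, hP, hcov⟩, fun hcov => ?_⟩
  choose U hU using fun x : X => (nhds x).exists_antitone_basis
  obtain ⟨h, hc, hi, hhU, hd⟩ := exists_disjoint_cantor_maps hX hcov U fun x m => (hU x).mem m
  set S : Set X := {x | ∃ x' m w, h x' m w = x} with hS
  refine ⟨{A | (∃ x ∉ S, A = insert x (⋃ m, range (h x m))) ∨
    ∃ x ∈ S, ∃ m, A = range (h x m)}, ?_, ?_, ?_⟩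
  · rintro A (⟨x, hx, rfl⟩ | ⟨x, -, m, rfl⟩)
    · exact nonempty_homeomorph_cantorSpace_iff.2 ⟨cantorGlue x (h x),
        continuous_cantorGlue (hc x) (hU x) (hhU x),
        injective_cantorGlue (hi x) (fun m n w w' hw => (hd _ _ _ _ _ _ hw).2)
          (fun m w hw => hx ⟨x, m, w, hw⟩), range_cantorGlue x (h x)⟩
    · exact nonempty_homeomorph_cantorSpace_iff.2 ⟨h x m, hc x m, hi x m, rfl⟩
  · intro A hA B hB hAB
    refine Set.disjoint_left.2 fun y hyA hyB => hAB ?_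
    simp only [id] at hyA hyB
    rcases hA with ⟨x, hx, rfl⟩ | ⟨x, hx, m, rfl⟩ <;>
      rcases hB with ⟨x', hx', rfl⟩ | ⟨x', hx', m', rfl⟩
    · simp only [mem_insert_iff, mem_iUnion, mem_range] at hyA hyB
      rcases hyA with rfl | ⟨m, w, rfl⟩ <;> rcases hyB with hy | ⟨m', w', hy⟩
      · rw [hy]
      · exact absurd ⟨x', m', w', hy⟩ hx
      · exact absurd ⟨x, m, w, hy⟩ hx'
      · rw [(hd _ _ _ _ _ _ hy).1]
    · simp only [mem_insert_iff, mem_iUnion, mem_range] at hyA hyB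
      obtain ⟨w', rfl⟩ := hyB
      rcases hyA with hy | ⟨m, w, hy⟩
      · exact absurd ⟨x', m', w', hy⟩ hx
      · exact absurd ((hd _ _ _ _ _ _ hy).1 ▸ hx') hx
    · simp only [mem_insert_iff, mem_iUnion, mem_range] at hyA hyB
      obtain ⟨w, rfl⟩ := hyA
      rcases hyB with hy | ⟨m', w', hy⟩
      · exact absurd ⟨x, m, w, hy⟩ hx'
      · exact absurd ((hd _ _ _ _ _ _ hy).1 ▸ hx) hx'
    · obtain ⟨w, rfl⟩ := hyA
      obtain ⟨w', hy⟩ := hyB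
      obtain ⟨rfl, rfl⟩ := hd _ _ _ _ _ _ hy
      rfl
  · refine eq_univ_of_forall fun y => ?_
    by_cases hy : y ∈ S
    · obtain ⟨x, m, w, rfl⟩ := hy
      by_cases hx : x ∈ S
      · exact ⟨_, Or.inr ⟨x, hx, m, rfl⟩, mem_range_self w⟩
      · exact ⟨_, Or.inl ⟨x, hx, rfl⟩, Or.inr (mem_iUnion.2 ⟨m, mem_range_self w⟩)⟩
    · exact ⟨_, Or.inl ⟨y, hy, rfl⟩, mem_insert _ _⟩
end

section
/- There is a first countable, hereditarily normal (T5) Hausdorff topological space X with |X| = 𝔠⁺ such that X is 2^ω-coverable but X is not 2^ω-partitionable. -/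
open Cardinal Set TopologicalSpace

open scoped NNReal Topology
open Filter

namespace CantorThickening

section Code

/-- A continuous injection of the Cantor space into the half-line, with values in `[0, 1]`. -/
noncomputable def code (x : CantorSpace) : ℝ≥0 :=
  ⟨(cantorSetHomeomorphNatToBool.symm x : ℝ),
    (cantorSet_subset_unitInterval (cantorSetHomeomorphNatToBool.symm x).2).1⟩

theorem continuous_code : Continuous code :=
  Continuous.subtype_mk
    (continuous_subtype_val.comp cantorSetHomeomorphNatToBool.symm.continuous) _

theorem code_injective : Function.Injective code := fun _ _ h =>
  cantorSetHomeomorphNatToBool.symm.injective (Subtype.ext (congrArg NNReal.toReal h))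

theorem code_le_one (x : CantorSpace) : code x ≤ 1 :=
  (cantorSet_subset_unitInterval (cantorSetHomeomorphNatToBool.symm x).2).2

theorem mk_cantorSpace : #CantorSpace = 𝔠 := by simp [CantorSpace]

/-- The Cantor space has no isolated points. -/
theorem exists_ne_mem_of_isOpen {U : Set CantorSpace} (hU : IsOpen U) {x : CantorSpace}
    (hx : x ∈ U) : ∃ y ∈ U, y ≠ x := by
  have h : Tendsto (fun n => Function.update x n (!x n)) atTop (𝓝 x) := by
    rw [tendsto_pi_nhds]
    intro k
    refine tendsto_const_nhds.congr' ?_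
    filter_upwards [eventually_gt_atTop k] with n hn
    rw [Function.update_of_ne hn.ne]
  obtain ⟨n, hn⟩ := (h.eventually (hU.mem_nhds hx)).exists
  refine ⟨_, hn, fun h => ?_⟩
  have := congrFun h n
  simp at this

end Code

section PressingDown

variable {W : Type} [LinearOrder W]

/-- `a` is the supremum of a strictly increasing sequence. -/
def IsOmegaLimit (a : W) : Prop :=
  ∃ s : ℕ → W, StrictMono s ∧ IsLUB (range s) a

/-- `a` has an immediate predecessor. -/
def IsSuccessor (a : W) : Prop := ∃ b, b ⋖ a

theorem IsOmegaLimit.not_isSuccessor {a : W} (h : IsOmegaLimit a) : ¬ IsSuccessor a := by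
  rintro ⟨b, hb⟩
  obtain ⟨s, hs, hl⟩ := h
  obtain ⟨_, ⟨n, rfl⟩, hn, -⟩ := hl.exists_between hb.lt
  have h1 : s (n + 1) ≤ a := hl.1 ⟨_, rfl⟩
  exact hb.2 hn ((hs n.lt_succ_self).trans_le h1)

theorem bddAbove_of_mk_le (hW : #W = Order.succ 𝔠) (hI : ∀ a : W, #(Iio a) ≤ 𝔠) {s : Set W}
    (hs : #s ≤ 𝔠) : BddAbove s := by
  by_contra h
  rw [not_bddAbove_iff] at h
  have huniv : (univ : Set W) ⊆ ⋃ a : s, Iio (a : W) := fun w _ => by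
    obtain ⟨a, ha, hw⟩ := h w
    exact mem_iUnion.2 ⟨⟨a, ha⟩, hw⟩
  have h1 : #W ≤ 𝔠 := by
    rw [← mk_univ]
    calc #(univ : Set W) ≤ #(⋃ a : s, Iio (a : W)) := mk_le_mk_of_subset huniv
      _ ≤ #s * ⨆ a : s, #(Iio (a : W)) := mk_iUnion_le _
      _ ≤ 𝔠 * 𝔠 := mul_le_mul' hs (ciSup_le' fun a => hI a)
      _ = 𝔠 := continuum_mul_self
  rw [hW] at h1
  exact (Order.lt_succ 𝔠).not_ge h1

variable [WellFoundedLT W] [NoMaxOrder W]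

theorem exists_covBy (a : W) : ∃ b, a ⋖ b := by
  obtain ⟨b, hb, hmin⟩ := WellFounded.has_min (wellFounded_lt (α := W)) (Ioi a) (exists_gt a)
  exact ⟨b, hb, fun c hc hcb => hmin c hc hcb⟩

/-- The pressing-down lemma for the set of points of countable cofinality. -/
theorem exists_large_fiber (hW : #W = Order.succ 𝔠) (hI : ∀ a : W, #(Iio a) ≤ 𝔠) (f : W → W)
    (hf : ∀ a, IsOmegaLimit a → f a < a) :
    ∃ b, ¬ #{a | IsOmegaLimit a ∧ f a = b} ≤ 𝔠 := by
  by_contra! h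
  choose g hg using fun b => bddAbove_of_mk_le hW hI (h b)
  have hstep : ∀ c : W, ∃ d, c < d ∧ ∀ b ≤ c, g b < d := by
    intro c
    obtain ⟨c', hc'⟩ := exists_gt c
    obtain ⟨d, hd⟩ := bddAbove_of_mk_le hW hI ((mk_image_le (f := g)).trans (hI c'))
    obtain ⟨e, he⟩ := exists_gt (max d c)
    exact ⟨e, (le_max_right _ _).trans_lt he, fun b hb =>
      ((hd ⟨b, hb.trans_lt hc', rfl⟩).trans (le_max_left _ _)).trans_lt he⟩
  choose next hnext hbound using hstep
  have : Nonempty W := by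
    rw [← mk_ne_zero_iff, hW]
    exact (continuum_pos.trans (Order.lt_succ 𝔠)).ne'
  obtain ⟨w⟩ := this
  let s : ℕ → W := fun n => next^[n] w
  have hsucc : ∀ n, s (n + 1) = next (s n) := fun n => Function.iterate_succ_apply' _ _ _
  have hs : StrictMono s := strictMono_nat_of_lt_succ fun n => by
    rw [hsucc]
    exact hnext _
  have hbdd : BddAbove (range s) :=
    bddAbove_of_mk_le hW hI ((mk_le_aleph0_iff.2 (countable_range s).to_subtype).trans
      aleph0_le_continuum)
  obtain ⟨a, ha, hmin⟩ := WellFounded.has_min (wellFounded_lt (α := W)) _ hbdd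
  have hlub : IsLUB (range s) a := ⟨ha, fun c hc => not_lt.1 (hmin c hc)⟩
  have hlim : IsOmegaLimit a := ⟨s, hs, hlub⟩
  obtain ⟨_, ⟨n, rfl⟩, hn, -⟩ := hlub.exists_between (hf a hlim)
  have h1 : a ≤ g (f a) := hg (f a) ⟨hlim, rfl⟩
  have h2 : g (f a) < s (n + 1) := by
    rw [hsucc]
    exact hbound _ _ hn.le
  exact (h1.trans_lt h2).not_ge (ha ⟨_, rfl⟩)

end PressingDown

/-- The lexicographic product of `W` with the half-line. -/
def LexRay (W : Type) : Type := W ×ₗ ℝ≥0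

namespace LexRay

variable {W : Type}

/-- The point of height `x` on the ray attached to `a`. -/
def mk (a : W) (x : ℝ≥0) : LexRay W := toLex (a, x)

/-- The index of the ray containing a point. -/
def level (p : LexRay W) : W := (ofLex p).1

/-- The position of a point on its ray. -/
def height (p : LexRay W) : ℝ≥0 := (ofLex p).2

@[simp] theorem level_mk (a : W) (x : ℝ≥0) : (mk a x).level = a := rfl

@[simp] theorem height_mk (a : W) (x : ℝ≥0) : (mk a x).height = x := rfl

theorem ext {p q : LexRay W} (h : p.level = q.level) (h' : p.height = q.height) : p = q :=
  ofLex.injective (Prod.ext h h')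

variable [LinearOrder W]

noncomputable instance : LinearOrder (LexRay W) := inferInstanceAs (LinearOrder (W ×ₗ ℝ≥0))

noncomputable instance : TopologicalSpace (LexRay W) := Preorder.topology _

instance : OrderTopology (LexRay W) := ⟨rfl⟩

theorem lt_iff {p q : LexRay W} :
    p < q ↔ p.level < q.level ∨ p.level = q.level ∧ p.height < q.height :=
  Prod.Lex.lt_iff

theorem continuous_mk (a : W) : Continuous (mk a) := by
  refine continuous_generateFrom_iff.2 ?_
  rintro _ ⟨p, rfl | rfl⟩
  · rcases lt_trichotomy p.level a with h | h | h
    · convert isOpen_univ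
      ext x
      simp [lt_iff, h]
    · convert isOpen_Ioi (a := p.height)
      ext x
      simp [lt_iff, h]
    · convert isOpen_empty
      ext x
      simp [lt_iff, h.not_gt, h.ne']
  · rcases lt_trichotomy p.level a with h | h | h
    · convert isOpen_empty
      ext x
      simp [lt_iff, h.not_gt, h.ne']
    · convert isOpen_Iio (a := p.height)
      ext x
      simp [lt_iff, h]
    · convert isOpen_univ
      ext x
      simp [lt_iff, h]

end LexRay

open LexRay

/-- A Cantor set on each ray indexed by a successor, and the origin of each ray indexed by a
limit of countable cofinality. -/
def Space (W : Type) [LinearOrder W] : Type :=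
  {p : LexRay W // IsSuccessor p.level ∧ p.height ∈ range code ∨
    IsOmegaLimit p.level ∧ p.height = 0}

namespace Space

variable {W : Type} [LinearOrder W]

noncomputable instance : TopologicalSpace (Space W) := instTopologicalSpaceSubtype

instance : T5Space (Space W) :=
  Topology.IsEmbedding.subtypeVal.t5Space

/-- The index of the ray containing a point. -/
def level (p : Space W) : W := p.1.level

/-- The point with a given code above a successor. -/
noncomputable def succPoint {a : W} (ha : IsSuccessor a) (x : CantorSpace) : Space W :=
  ⟨mk a (code x), .inl ⟨ha, x, rfl⟩⟩

/-- The point above a limit of countable cofinality. -/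
def limPoint {a : W} (ha : IsOmegaLimit a) : Space W :=
  ⟨mk a 0, .inr ⟨ha, rfl⟩⟩

theorem eq_succPoint (p : Space W) (hp : IsSuccessor p.level) : ∃ x, p = succPoint hp x := by
  obtain ⟨p, ⟨h, x, hx⟩ | ⟨h, -⟩⟩ := p
  · exact ⟨x, Subtype.ext (LexRay.ext rfl hx.symm)⟩
  · exact absurd hp h.not_isSuccessor

theorem eq_limPoint (p : Space W) (hp : IsOmegaLimit p.level) : p = limPoint hp := by
  obtain ⟨p, ⟨h, -⟩ | ⟨h, hx⟩⟩ := p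
  · exact absurd h hp.not_isSuccessor
  · exact Subtype.ext (LexRay.ext rfl hx)

theorem isSuccessor_or_isOmegaLimit (p : Space W) :
    IsSuccessor p.level ∨ IsOmegaLimit p.level :=
  p.2.imp And.left And.left

theorem height_le_one (p : Space W) : p.1.height ≤ 1 := by
  obtain ⟨p, ⟨-, x, hx⟩ | ⟨-, hx⟩⟩ := p
  · exact hx.symm.trans_le (code_le_one x)
  · exact hx.trans_le zero_le_one

theorem lt_mk_two_iff {p : Space W} {a : W} : p.1 < mk a 2 ↔ p.level ≤ a := by
  have := p.height_le_one.trans_lt one_lt_two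
  rw [lt_iff, le_iff_lt_or_eq]
  simp [level, this]

theorem mk_two_lt_iff {p : Space W} {a : W} : mk a 2 < p.1 ↔ a < p.level := by
  have := (p.height_le_one.trans_lt one_lt_two).not_gt
  rw [lt_iff]
  simp [level, this]

theorem isOpen_level_le (a : W) : IsOpen {p : Space W | p.level ≤ a} := by
  simp_rw [← lt_mk_two_iff]
  exact isOpen_Iio.preimage continuous_subtype_val

theorem isOpen_lt_level (a : W) : IsOpen {p : Space W | a < p.level} := by
  simp_rw [← mk_two_lt_iff]
  exact isOpen_Ioi.preimage continuous_subtype_val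

theorem continuous_succPoint {a : W} (ha : IsSuccessor a) : Continuous (succPoint ha) :=
  Continuous.subtype_mk ((LexRay.continuous_mk a).comp continuous_code) _

theorem succPoint_injective {a : W} (ha : IsSuccessor a) : Function.Injective (succPoint ha) :=
  fun _ _ h => code_injective (congrArg (fun p : Space W => p.1.height) h)

theorem range_succPoint {a : W} (ha : IsSuccessor a) :
    range (succPoint ha) = {p : Space W | p.level = a} := by
  ext p
  constructor
  · rintro ⟨x, rfl⟩
    rfl
  · rintro rfl
    obtain ⟨x, hx⟩ := p.eq_succPoint ha
    exact ⟨x, hx.symm⟩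

theorem isOpenEmbedding_succPoint {a : W} (ha : IsSuccessor a) :
    Topology.IsOpenEmbedding (succPoint ha) := by
  refine ⟨((continuous_succPoint ha).isClosedEmbedding (succPoint_injective ha)).isEmbedding, ?_⟩
  obtain ⟨b, hb⟩ := id ha
  rw [range_succPoint]
  convert (isOpen_lt_level b).inter (isOpen_level_le a) using 1
  ext p
  exact ⟨fun h => ⟨hb.lt.trans_eq h.symm, h.le⟩,
    fun h => h.2.antisymm (not_lt.1 fun h' => hb.2 h.1 h')⟩

theorem nhds_limPoint_hasBasis {a : W} (ha : IsOmegaLimit a) {s : ℕ → W}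
    (hs : StrictMono s) (hl : IsLUB (range s) a) :
    (𝓝 (limPoint ha)).HasBasis (fun _ : ℕ => True)
      fun n => {p : Space W | s n < p.level} ∩ {p | p.level ≤ a} := by
  refine ⟨fun t => ⟨fun ht => ?_, ?_⟩⟩
  · obtain ⟨u, hu, hut⟩ := mem_nhds_subtype _ _ _ |>.1 ht
    have hlt : ∀ n, s n < a := fun n => (hs n.lt_succ_self).trans_le (hl.1 ⟨_, rfl⟩)
    obtain ⟨q, hq, hqu⟩ := exists_Ioc_subset_of_mem_nhds hu
      ⟨mk (s 0) 0, lt_iff.2 (.inl (hlt 0))⟩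
    have hqa : q.level < a := by
      rcases lt_iff.1 hq with h | ⟨-, h⟩
      · exact h
      · exact absurd h not_lt_zero
    obtain ⟨_, ⟨n, rfl⟩, hn, -⟩ := hl.exists_between hqa
    refine ⟨n, trivial, fun p hp => hut (hqu ⟨lt_iff.2 (.inl (hn.trans hp.1)), ?_⟩)⟩
    rcases hp.2.lt_or_eq with h | h
    · exact (lt_iff.2 (.inl h)).le
    · subst h
      rw [← p.eq_limPoint ha]
  · rintro ⟨n, -, hn⟩
    refine mem_of_superset (((isOpen_lt_level _).inter (isOpen_level_le a)).mem_nhds ⟨?_, ?_⟩) hn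
    · exact (hs n.lt_succ_self).trans_le (hl.1 ⟨_, rfl⟩)
    · exact le_rfl

instance : FirstCountableTopology (Space W) where
  nhds_generated_countable p := by
    rcases p.isSuccessor_or_isOmegaLimit with h | h
    · obtain ⟨x, hx⟩ := p.eq_succPoint h
      rw [hx, ← (isOpenEmbedding_succPoint h).map_nhds_eq]
      infer_instance
    · obtain ⟨s, hs, hl⟩ := id h
      rw [p.eq_limPoint h]
      exact (nhds_limPoint_hasBasis h hs hl).isCountablyGenerated

open Classical in
/-- A parametrization of a Cantor set consisting of a limit point and clopen pieces of the Cantor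
sets above successors converging to it. -/
noncomputable def limMap {a : W} (ha : IsOmegaLimit a) {s : ℕ → W} (hs : ∀ n, IsSuccessor (s n))
    (x : CantorSpace) : Space W :=
  if h : ∃ n, x n = true then succPoint (hs (Nat.find h)) x else limPoint ha

section LimMap

variable {a : W} (ha : IsOmegaLimit a) {s : ℕ → W} (hs : ∀ n, IsSuccessor (s n))

theorem limMap_of_first {x : CantorSpace} {n : ℕ} (hn : x n = true) (h : ∀ k < n, x k = false) :
    limMap ha hs x = succPoint (hs n) x := by
  classical
  have hex : ∃ n, x n = true := ⟨n, hn⟩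
  have : Nat.find hex = n := (Nat.find_eq_iff hex).2 ⟨hn, fun k hk => by simp [h k hk]⟩
  rw [limMap, dif_pos hex]
  subst this
  rfl

theorem limMap_zero {x : CantorSpace} (h : ¬ ∃ n, x n = true) : limMap ha hs x = limPoint ha :=
  dif_neg h

theorem exists_first {x : CantorSpace} (h : ∃ n, x n = true) :
    ∃ n, x n = true ∧ ∀ k < n, x k = false := by
  classical
  exact ⟨Nat.find h, Nat.find_spec h, fun k hk => by simpa using Nat.find_min h hk⟩

theorem limMap_injective : Function.Injective (limMap ha hs) := by
  intro x y hxy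
  by_cases hx : ∃ n, x n = true <;> by_cases hy : ∃ n, y n = true
  · obtain ⟨n, hn, hn'⟩ := exists_first hx
    obtain ⟨m, hm, hm'⟩ := exists_first hy
    rw [limMap_of_first ha hs hn hn', limMap_of_first ha hs hm hm'] at hxy
    exact code_injective (congrArg (fun p : Space W => p.1.height) hxy)
  · obtain ⟨n, hn, hn'⟩ := exists_first hx
    rw [limMap_of_first ha hs hn hn', limMap_zero ha hs hy] at hxy
    have : s n = a := congrArg level hxy
    exact absurd (this ▸ hs n) ha.not_isSuccessor
  · obtain ⟨n, hn, hn'⟩ := exists_first hy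
    rw [limMap_of_first ha hs hn hn', limMap_zero ha hs hx] at hxy
    have : a = s n := congrArg level hxy
    exact absurd (this ▸ hs n) ha.not_isSuccessor
  · funext n
    have h1 := fun h => hx ⟨n, h⟩
    have h2 := fun h => hy ⟨n, h⟩
    rw [Bool.eq_false_iff.2 h1, Bool.eq_false_iff.2 h2]

theorem eventually_agree (x : CantorSpace) (n : ℕ) : ∀ᶠ y in 𝓝 x, ∀ k ≤ n, y k = x k := by
  refine (finite_Iic n).eventually_all.2 fun k _ => ?_
  exact ((isOpen_discrete {x k}).preimage (continuous_apply (A := fun _ => Bool) k)).mem_nhds rfl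

theorem continuous_limMap (hmono : StrictMono s) (hl : IsLUB (range s) a) :
    Continuous (limMap ha hs) := by
  rw [continuous_iff_continuousAt]
  intro x
  by_cases hx : ∃ n, x n = true
  · obtain ⟨n, hn, hn'⟩ := exists_first hx
    refine (continuous_succPoint (hs n)).continuousAt.congr ?_
    filter_upwards [eventually_agree x n] with y hy
    exact (limMap_of_first ha hs ((hy n le_rfl).trans hn)
      fun k hk => (hy k hk.le).trans (hn' k hk)).symm
  · rw [ContinuousAt, limMap_zero ha hs hx, (nhds_limPoint_hasBasis ha hmono hl).tendsto_right_iff]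
    intro n _
    have hlt : ∀ n, s n < a := fun n => (hmono n.lt_succ_self).trans_le (hl.1 ⟨_, rfl⟩)
    filter_upwards [eventually_agree x n] with y hy
    by_cases hyt : ∃ m, y m = true
    · obtain ⟨m, hm, hm'⟩ := exists_first hyt
      rw [limMap_of_first ha hs hm hm']
      refine ⟨hmono (not_le.1 fun h => hx ⟨m, (hy m h).symm.trans hm⟩), (hlt m).le⟩
    · rw [limMap_zero ha hs hyt]
      exact ⟨hlt n, le_rfl⟩

end LimMap

theorem nonempty_homeomorph_range {f : CantorSpace → Space W} (hf : Continuous f)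
    (hi : Function.Injective f) : Nonempty (range f ≃ₜ CantorSpace) :=
  ⟨(hf.isClosedEmbedding hi).isEmbedding.toHomeomorph.symm⟩

theorem coverable [WellFoundedLT W] [NoMaxOrder W] : Coverable (Space W) CantorSpace := by
  refine ⟨{K | Nonempty (K ≃ₜ CantorSpace)}, fun K hK => hK, eq_univ_of_forall fun p => ?_⟩
  rcases p.isSuccessor_or_isOmegaLimit with h | h
  · obtain ⟨x, hx⟩ := p.eq_succPoint h
    exact ⟨_, nonempty_homeomorph_range (continuous_succPoint h) (succPoint_injective h),
      x, hx.symm⟩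
  · obtain ⟨s, hs, hl⟩ := id h
    choose t ht using fun n => exists_covBy (s n)
    have hts : ∀ n, t n ≤ s (n + 1) := fun n =>
      not_lt.1 fun h' => (ht n).2 (hs n.lt_succ_self) h'
    have htm : StrictMono t := strictMono_nat_of_lt_succ fun n => (hts n).trans_lt (ht _).lt
    have htl : IsLUB (range t) p.level := by
      constructor
      · rintro _ ⟨n, rfl⟩
        exact (hts n).trans (hl.1 ⟨_, rfl⟩)
      · intro b hb
        refine hl.2 ?_
        rintro _ ⟨n, rfl⟩
        exact (ht n).le.trans (hb ⟨n, rfl⟩)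
    have htS : ∀ n, IsSuccessor (t n) := fun n => ⟨_, ht n⟩
    exact ⟨_, nonempty_homeomorph_range (continuous_limMap h htS htm htl)
      (limMap_injective h htS), fun _ => false,
      (limMap_zero h htS (by simp)).trans (p.eq_limPoint h).symm⟩

theorem exists_ne_mem_inter {K : Set (Space W)} (hK : Nonempty (K ≃ₜ CantorSpace))
    {U : Set (Space W)} (hU : IsOpen U) {p : Space W} (hp : p ∈ K) (hpU : p ∈ U) :
    ∃ q ∈ K, q ∈ U ∧ q ≠ p := by
  obtain ⟨e⟩ := hK
  obtain ⟨y, hy, hne⟩ := exists_ne_mem_of_isOpen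
    (hU.preimage (continuous_subtype_val.comp e.symm.continuous)) (x := e ⟨p, hp⟩)
    (by simpa using hpU)
  refine ⟨e.symm y, (e.symm y).2, hy, fun h => hne ?_⟩
  rw [← e.apply_symm_apply y]
  exact congrArg e (Subtype.ext h)

/-- A Cantor set through a limit point contains a point of a lower level. -/
theorem exists_lower_mem {K : Set (Space W)}
    (hK : Nonempty (K ≃ₜ CantorSpace)) {a : W} (ha : IsOmegaLimit a) (hp : limPoint ha ∈ K) :
    ∃ q ∈ K, q.level < a := by
  obtain ⟨q, hq, hqa, hne⟩ := exists_ne_mem_inter hK (isOpen_level_le a) hp (le_refl a)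
  refine ⟨q, hq, lt_of_le_of_ne hqa ?_⟩
  rintro rfl
  exact hne (q.eq_limPoint ha)

theorem mk_level_fiber_le (b : W) : #{q : Space W | q.level = b} ≤ 𝔠 := by
  have hinj : Function.Injective
      (fun q : {q : Space W | q.level = b} => ((q.1.1.height : ℝ≥0) : ℝ)) := fun p q h =>
    Subtype.ext (Subtype.ext (LexRay.ext (p.2.trans q.2.symm) (NNReal.coe_injective h)))
  exact (mk_le_of_injective hinj).trans mk_real.le

theorem not_partitionable [WellFoundedLT W] [NoMaxOrder W] (hW : #W = Order.succ 𝔠)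
    (hI : ∀ a : W, #(Iio a) ≤ 𝔠) : ¬ Partitionable (Space W) CantorSpace := by
  rintro ⟨P, hP, hdisj, hcov⟩
  choose part hpart hmem using fun p : Space W =>
    (hcov.symm ▸ mem_univ p : p ∈ ⋃₀ P)
  have key : ∀ a : W, ∃ b, ∀ ha : IsOmegaLimit a,
      b < a ∧ ∃ q : Space W, q.level = b ∧ limPoint ha ∈ part q := by
    intro a
    by_cases ha : IsOmegaLimit a
    · obtain ⟨q, hq, hqa⟩ := exists_lower_mem (hP _ (hpart (limPoint ha))) ha (hmem _)
      refine ⟨q.level, fun _ => ⟨hqa, q, rfl, ?_⟩⟩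
      have : part q = part (limPoint ha) :=
        hdisj.elim_set (hpart _) (hpart _) q (hmem q) hq
      exact this ▸ hmem _
    · exact ⟨a, fun h => absurd h ha⟩
  choose f hf using key
  obtain ⟨b, hb⟩ := exists_large_fiber hW hI f fun a ha => (hf a ha).1
  refine hb ?_
  have hsub : {a | IsOmegaLimit a ∧ f a = b} ⊆
      ⋃ q : {q : Space W | q.level = b}, level '' part q := by
    rintro a ⟨ha, rfl⟩
    obtain ⟨q, hq, hqa⟩ := (hf a ha).2
    exact mem_iUnion.2 ⟨⟨q, hq⟩, _, hqa, rfl⟩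
  calc #{a | IsOmegaLimit a ∧ f a = b}
      ≤ #(⋃ q : {q : Space W | q.level = b}, level '' part q) := mk_le_mk_of_subset hsub
    _ ≤ #{q : Space W | q.level = b} * ⨆ q : {q : Space W | q.level = b}, #(level '' part q) :=
        mk_iUnion_le _
    _ ≤ 𝔠 * 𝔠 := by
        refine mul_le_mul' (mk_level_fiber_le b) (ciSup_le' fun q => mk_image_le.trans ?_)
        obtain ⟨e⟩ := hP _ (hpart q)
        rw [mk_congr e.toEquiv, mk_cantorSpace]
    _ = 𝔠 := continuum_mul_self

theorem mk_space [WellFoundedLT W] [NoMaxOrder W] (hW : #W = Order.succ 𝔠) :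
    #(Space W) = Order.succ 𝔠 := by
  apply le_antisymm
  · have hinj : Function.Injective
        (fun p : Space W => (p.level, ((p.1.height : ℝ≥0) : ℝ))) := fun p q h =>
      Subtype.ext (LexRay.ext (Prod.ext_iff.1 h).1 (NNReal.coe_injective (Prod.ext_iff.1 h).2))
    refine (mk_le_of_injective hinj).trans ?_
    rw [mk_prod, lift_id, lift_id, hW, mk_real]
    have hle : 𝔠 ≤ Order.succ 𝔠 := Order.le_succ 𝔠
    exact (mul_le_mul' le_rfl hle).trans (mul_eq_self (aleph0_le_continuum.trans hle)).le
  · choose t ht using exists_covBy (W := W)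
    have hinj : Function.Injective
        (fun w : W => succPoint (⟨w, ht w⟩ : IsSuccessor (t w)) fun _ => false) := by
      intro v w h
      have h' : t v = t w := congrArg level h
      exact (ht v).unique_left (h' ▸ ht w)
    exact hW.symm.le.trans (mk_le_of_injective hinj)

end Space

end CantorThickening

open CantorThickening in
theorem stmt_4 :
    ∃ (X : Type) (t : TopologicalSpace X),
      @T2Space X t ∧ @FirstCountableTopology X t ∧ @T5Space X t ∧
      Cardinal.mk X = Order.succ Cardinal.continuum ∧
      @Coverable X CantorSpace t _ ∧ ¬ @Partitionable X CantorSpace t _ := by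
  have hinf : ℵ₀ ≤ Order.succ 𝔠 := aleph0_le_continuum.trans (Order.le_succ 𝔠)
  let W : Type := (Order.succ 𝔠).ord.ToType
  have : NoMaxOrder W := Cardinal.noMaxOrder hinf
  have hW : #W = Order.succ 𝔠 := mk_ord_toType _
  have hI : ∀ a : W, #(Iio a) ≤ 𝔠 := fun a =>
    Order.lt_succ_iff.1
      ((mk_Iio_lt a ((congrArg ord hW).trans (Ordinal.type_toType _).symm)).trans_eq hW)
  exact ⟨Space W, inferInstance, inferInstance, inferInstance, inferInstance,
    Space.mk_space hW, Space.coverable, Space.not_partitionable hW hI⟩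
end

section
/- Suppose X is a metrizable space with |X| ≤ 𝔠^{+ω}. Then X is 2^ω-partitionable if and only if X is 2^ω-coverable. -/
open Cardinal Set TopologicalSpace

/-- `𝔠^{+ω}`, the least limit cardinal above `𝔠`: the supremum of the finitely iterated
cardinal successors of `𝔠`. -/
noncomputable def contSuccOmega : Cardinal.{u} :=
  ⨆ n : ℕ, (Order.succ)^[n] Cardinal.continuum


/-- Every type has a well-order whose proper initial segments have smaller cardinality. -/
theorem exists_wellOrder_mk_lt (α : Type u) :
    ∃ (r : α → α → Prop) (_ : IsWellOrder α r), ∀ a, #{b // r b a} < #α := by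
  obtain ⟨r, wo, h⟩ := Cardinal.exists_ord_eq α
  refine ⟨r, wo, fun a => ?_⟩
  have := card_typein_lt (r := r) a h
  rwa [Ordinal.typein] at this

theorem succ_power_aleph0 {κ : Cardinal.{u}} (hκ : ℵ₀ ≤ κ) (h : κ ^ ℵ₀ = κ) :
    Order.succ κ ^ ℵ₀ = Order.succ κ := by
  refine le_antisymm ?_ (self_le_power _ one_le_aleph0)
  obtain ⟨α, hα⟩ : ∃ α : Type u, #α = Order.succ κ := ⟨_, mk_out _⟩
  obtain ⟨r, wo, hr⟩ := exists_wellOrder_mk_lt α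
  have hseg : ∀ a, #{b | r b a} ≤ κ := fun a => Order.lt_succ_iff.1 (hα ▸ hr a)
  have hcov : (⋃ a : α, {f : ℕ → α | ∀ n, r (f n) a}) = Set.univ := by
    refine Set.eq_univ_of_forall fun f => ?_
    by_contra hf
    simp only [mem_iUnion, mem_ofPred_eq, not_exists, not_forall] at hf
    have hall : (⋃ n, ({b | r b (f n)} ∪ {f n})) = (Set.univ : Set α) := by
      refine Set.eq_univ_of_forall fun a => ?_
      obtain ⟨n, hn⟩ := hf a
      refine mem_iUnion.2 ⟨n, ?_⟩
      rcases trichotomous_of r (f n) a with h | h | h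
      · exact absurd h hn
      · exact Or.inr h.symm
      · exact Or.inl h
    have hle : #(Set.univ : Set α) ≤ κ := by
      rw [← hall]
      have h1 := mk_iUnion_le_lift (fun n : ℕ => ({b | r b (f n)} ∪ {f n} : Set α))
      simp only [lift_id', mk_nat, lift_aleph0] at h1
      refine h1.trans ((mul_le_mul' hκ (ciSup_le' fun n => ?_)).trans (mul_eq_self hκ).le)
      refine (mk_union_le _ _).trans ?_
      rw [mk_singleton]
      exact (add_le_add (hseg _) (one_le_aleph0.trans hκ)).trans (add_eq_self hκ).le
    rw [mk_univ, hα] at hle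
    exact (Order.lt_succ κ).not_ge hle
  have hpow : Order.succ κ ^ ℵ₀ = #(Set.univ : Set (ℕ → α)) := by
    rw [mk_univ, ← hα]; simp
  rw [hpow, ← hcov]
  refine (mk_iUnion_le _).trans ?_
  have hs : ℵ₀ ≤ Order.succ κ := hκ.trans (Order.le_succ κ)
  rw [hα]
  refine (mul_le_mul' le_rfl (ciSup_le' fun a => ?_)).trans (mul_eq_self hs).le
  refine le_trans ?_ (Order.le_succ κ)
  calc #{f : ℕ → α | ∀ n, r (f n) a} ≤ #(ℕ → {b | r b a}) :=
        mk_le_of_injective (f := fun f n => ⟨f.1 n, f.2 n⟩) fun f g hfg =>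
          Subtype.ext (funext fun n => congrArg Subtype.val (congrFun hfg n))
    _ = #{b | r b a} ^ ℵ₀ := by simp
    _ ≤ κ ^ ℵ₀ := power_le_power_right (hseg a)
    _ = κ := h

theorem exists_eq_succ_iterate {κ : Cardinal.{u}} (h₁ : 𝔠 ≤ κ) (h₂ : κ < contSuccOmega) :
    ∃ n : ℕ, κ = Order.succ^[n] 𝔠 := by
  obtain ⟨n, hn⟩ := exists_lt_of_lt_ciSup h₂
  induction n with
  | zero => exact absurd hn h₁.not_gt
  | succ n ih =>
    rw [Function.iterate_succ_apply', Order.lt_succ_iff] at hn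
    rcases hn.lt_or_eq with h | h
    · exact ih h
    · exact ⟨n, h⟩

theorem power_aleph0_eq_of_lt_contSuccOmega {κ : Cardinal.{u}} (h₁ : 𝔠 ≤ κ)
    (h₂ : κ < contSuccOmega) : κ ^ ℵ₀ = κ := by
  obtain ⟨n, rfl⟩ := exists_eq_succ_iterate h₁ h₂
  clear h₁ h₂
  suffices h : (𝔠 : Cardinal.{u}) ≤ Order.succ^[n] 𝔠 ∧
      (Order.succ^[n] 𝔠 : Cardinal.{u}) ^ ℵ₀ = Order.succ^[n] 𝔠 from h.2
  induction n with
  | zero => exact ⟨le_rfl, continuum_power_aleph0⟩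
  | succ n ih =>
    rw [Function.iterate_succ_apply']
    exact ⟨ih.1.trans (Order.le_succ _),
      succ_power_aleph0 (aleph0_le_continuum.trans ih.1) ih.2⟩

theorem countable_Icc_continuum_contSuccOmega :
    (Set.Icc 𝔠 contSuccOmega : Set Cardinal.{u}).Countable := by
  refine ((countable_range fun n : ℕ => Order.succ^[n] (𝔠 : Cardinal.{u})).insert
    contSuccOmega).mono fun κ hκ => ?_
  rcases hκ.2.eq_or_lt with h | h
  · exact Or.inl h
  · obtain ⟨n, hn⟩ := exists_eq_succ_iterate hκ.1 h
    exact Or.inr ⟨n, hn.symm⟩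

/-- Greedy choice of distinct representatives. -/
theorem exists_injective_mem {ι : Type u} {α : Type v} (W : ι → Set α)
    (hW : ∀ i, Nonempty (ι ↪ W i)) :
    ∃ f : ι → α, Function.Injective f ∧ ∀ i, f i ∈ W i := by
  obtain ⟨r, wo, hr⟩ := exists_wellOrder_mk_lt ι
  have key : ∀ i (g : ∀ j, r j i → α), ∃ a ∈ W i, ∀ j h, g j h ≠ a := by
    intro i g
    by_contra hcon
    push Not at hcon
    choose j hj hg using hcon
    obtain ⟨e⟩ := hW i
    have hle : #ι ≤ #{b // r b i} :=
      mk_le_of_injective (f := fun k => ⟨j (e k) (e k).2, hj _ _⟩) fun k l hkl => by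
        have h1 := hg (e k) (e k).2
        have h2 := hg (e l) (e l).2
        have h3 : j (e k) (e k).2 = j (e l) (e l).2 := congrArg Subtype.val hkl
        refine e.injective (Subtype.ext ?_)
        rw [← h1, ← h2]
        congr 1
    exact (hr i).not_ge hle
  choose c hc hne using key
  let f : ι → α := wo.wf.fix c
  have hf : ∀ i, f i = c i fun j _ => f j := fun i => wo.wf.fix_eq c i
  have hlt : ∀ i j, r j i → f j ≠ f i := fun i j h => by
    rw [hf i]; exact hne i (fun j _ => f j) j h
  refine ⟨f, fun i j hij => ?_, fun i => by rw [hf]; exact hc _ _⟩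
  rcases trichotomous_of r i j with h | h | h
  · exact absurd hij (hlt _ _ h)
  · exact h
  · exact absurd hij.symm (hlt _ _ h)

/-- `K` is the image of the Cantor space under a continuous injection. -/
def IsCantorSet {X : Type*} [TopologicalSpace X] (K : Set X) : Prop :=
  ∃ g : CantorSpace → X, Continuous g ∧ Function.Injective g ∧ range g = K

section CantorSet

variable {X : Type*} [TopologicalSpace X]

theorem isCantorSet_iff_nonempty_homeomorph [T2Space X] {K : Set X} :
    IsCantorSet K ↔ Nonempty (K ≃ₜ CantorSpace) := by
  constructor
  · rintro ⟨g, hc, hi, rfl⟩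
    exact ⟨(hc.isClosedEmbedding hi).isEmbedding.toHomeomorph.symm⟩
  · rintro ⟨e⟩
    refine ⟨fun y => (e.symm y : X), continuous_subtype_val.comp e.symm.continuous,
      Subtype.val_injective.comp e.symm.injective, ?_⟩
    rw [show (fun y => (e.symm y : X)) = Subtype.val ∘ e.symm from rfl,
      e.symm.surjective.range_comp, Subtype.range_coe]

theorem IsCantorSet.nonempty {K : Set X} (hK : IsCantorSet K) : K.Nonempty := by
  obtain ⟨g, -, -, rfl⟩ := hK
  exact range_nonempty g

theorem IsCantorSet.nonempty_embedding {K : Set X} (hK : IsCantorSet K) :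
    Nonempty (CantorSpace ↪ K) := by
  obtain ⟨g, -, hi, rfl⟩ := hK
  exact ⟨⟨fun y => ⟨g y, y, rfl⟩, fun y z h => hi (congrArg Subtype.val h)⟩⟩

theorem IsCantorSet.mk_eq {X : Type u} [TopologicalSpace X] {K : Set X} (hK : IsCantorSet K) :
    #K = 𝔠 := by
  obtain ⟨g, -, hi, rfl⟩ := hK
  have := mk_range_eq_of_injective hi
  simpa using this

/-- Overwrite the first `n` digits of the shifted sequence `y` by those of `a`. -/
def prependDigits (a : CantorSpace) (n : ℕ) (y : CantorSpace) : CantorSpace :=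
  fun k => if k < n then a k else y (k - n)

theorem continuous_prependDigits (a : CantorSpace) (n : ℕ) : Continuous (prependDigits a n) := by
  refine continuous_pi fun k => ?_
  unfold prependDigits
  split_ifs <;> fun_prop

theorem injective_prependDigits (a : CantorSpace) (n : ℕ) :
    Function.Injective (prependDigits a n) := by
  intro y z h
  funext k
  simpa [prependDigits] using congrFun h (k + n)

theorem range_prependDigits (a : CantorSpace) (n : ℕ) :
    range (prependDigits a n) = PiNat.cylinder a n := by
  ext z
  rw [PiNat.mem_cylinder_iff]
  constructor
  · rintro ⟨y, rfl⟩ k hk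
    simp [prependDigits, hk]
  · intro h
    refine ⟨fun k => z (k + n), funext fun k => ?_⟩
    by_cases hk : k < n
    · simp [prependDigits, hk, h k hk]
    · simp [prependDigits, hk, Nat.sub_add_cancel (not_lt.1 hk)]

theorem isCantorSet_cylinder (a : CantorSpace) (n : ℕ) :
    IsCantorSet (X := CantorSpace) (PiNat.cylinder a n) :=
  ⟨_, continuous_prependDigits a n, injective_prependDigits a n, range_prependDigits a n⟩

theorem exists_cylinder_subset {a : CantorSpace} {U : Set CantorSpace} (hU : U ∈ nhds a) :
    ∃ n, PiNat.cylinder a n ⊆ U := by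
  obtain ⟨s, ⟨b, n, rfl⟩, ha, hs⟩ :=
    (PiNat.isTopologicalBasis_cylinders fun _ : ℕ => Bool).mem_nhds_iff.1 hU
  exact ⟨n, (PiNat.mem_cylinder_iff_eq.1 ha).trans_subset hs⟩

theorem IsCantorSet.image {Y : Type*} [TopologicalSpace Y] {f : X → Y} (hf : Continuous f)
    (hi : Function.Injective f) {K : Set X} (hK : IsCantorSet K) : IsCantorSet (f '' K) := by
  obtain ⟨g, hc, hg, rfl⟩ := hK
  exact ⟨f ∘ g, hf.comp hc, hi.comp hg, range_comp f g⟩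

theorem IsCantorSet.exists_subset {K U : Set X} {x : X} (hK : IsCantorSet K) (hx : x ∈ K)
    (hU : U ∈ nhds x) : ∃ L ⊆ K ∩ U, x ∈ L ∧ IsCantorSet L := by
  obtain ⟨g, hc, hi, rfl⟩ := hK
  obtain ⟨a, rfl⟩ := hx
  obtain ⟨n, hn⟩ := exists_cylinder_subset (hc.continuousAt.preimage_mem_nhds hU)
  refine ⟨g '' PiNat.cylinder a n, subset_inter (image_subset_range _ _) (image_subset_iff.2 hn),
    mem_image_of_mem g (PiNat.self_mem_cylinder a n), (isCantorSet_cylinder a n).image hc hi⟩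

/-- A point together with a disjoint sequence of Cantor sets converging to it is a Cantor set. -/
theorem isCantorSet_insert_iUnion {x : X} {P : ℕ → Set X} (hP : ∀ n, IsCantorSet (P n))
    (hd : Pairwise (Function.onFun Disjoint P)) (hx : ∀ n, x ∉ P n)
    (hlim : ∀ U ∈ nhds x, ∀ᶠ n in Filter.atTop, P n ⊆ U) :
    IsCantorSet (insert x (⋃ n, P n)) := by
  classical
  choose g hc hi hr using hP
  let Φ : CantorSpace → X := fun y =>
    if h : ∃ k, y k = true then g (Nat.find h) (fun j => y (Nat.find h + 1 + j)) else x
  have hΦ : ∀ (y : CantorSpace) n, y n = true → (∀ k < n, y k = false) →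
      Φ y = g n (fun j => y (n + 1 + j)) := by
    intro y n hn hlt
    have h : ∃ k, y k = true := ⟨n, hn⟩
    have hfind : Nat.find h = n := (Nat.find_eq_iff h).2 ⟨hn, fun k hk => by simp [hlt k hk]⟩
    simp only [Φ, dif_pos h, hfind]
  have hcases : ∀ y : CantorSpace, (∃ n, y n = true ∧ ∀ k < n, y k = false) ∨
      y = fun _ => false := by
    intro y
    by_cases h : ∃ k, y k = true
    · exact Or.inl ⟨Nat.find h, Nat.find_spec h, fun k hk => by simpa using Nat.find_min h hk⟩
    · exact Or.inr (funext fun k => by simpa using not_exists.1 h k)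
  have hΦ0 : Φ (fun _ => false) = x := by simp [Φ]
  have hmem : ∀ n y, g n y ∈ P n := fun n y => hr n ▸ mem_range_self y
  refine ⟨Φ, ?_, ?_, ?_⟩
  · refine continuous_iff_continuousAt.2 fun y => ?_
    rcases hcases y with ⟨n, hn, hlt⟩ | rfl
    · have heq : (fun z : CantorSpace => g n (fun j => z (n + 1 + j))) =ᶠ[nhds y] Φ := by
        filter_upwards [(PiNat.isOpen_cylinder (fun _ : ℕ => Bool) y (n + 1)).mem_nhds
          (PiNat.self_mem_cylinder y (n + 1))] with z hz
        rw [PiNat.mem_cylinder_iff] at hz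
        exact (hΦ z n ((hz n n.lt_succ_self).trans hn) fun k hk =>
          (hz k (hk.trans n.lt_succ_self)).trans (hlt k hk)).symm
      refine ContinuousAt.congr (Continuous.continuousAt ((hc n).comp ?_)) heq
      fun_prop
    · intro U hU
      rw [hΦ0] at hU
      obtain ⟨m, hm⟩ := Filter.eventually_atTop.1 (hlim U hU)
      rw [Filter.mem_map]
      filter_upwards [(PiNat.isOpen_cylinder (fun _ : ℕ => Bool) (fun _ => false) m).mem_nhds
          (PiNat.self_mem_cylinder _ m)] with z hz
      rw [PiNat.mem_cylinder_iff] at hz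
      rcases hcases z with ⟨n, hn, hlt⟩ | rfl
      · rw [mem_preimage, hΦ z n hn hlt]
        refine hm n (not_lt.1 fun hnm => ?_) (hmem _ _)
        simp [hz n hnm] at hn
      · rw [mem_preimage, hΦ0]
        exact mem_of_mem_nhds hU
  · intro y z hyz
    rcases hcases y with ⟨n, hn, hlt⟩ | rfl <;> rcases hcases z with ⟨m, hm, hlt'⟩ | rfl
    · rw [hΦ y n hn hlt, hΦ z m hm hlt'] at hyz
      have hnm : n = m := by
        by_contra hne
        exact disjoint_left.1 (hd hne) (hmem n _) (hyz ▸ hmem m _)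
      subst hnm
      have hs := hi n hyz
      funext k
      rcases lt_trichotomy k n with h | h | h
      · rw [hlt k h, hlt' k h]
      · rw [h, hn, hm]
      · have := congrFun hs (k - (n + 1))
        simpa [Nat.add_sub_cancel' h] using this
    · rw [hΦ y n hn hlt, hΦ0] at hyz
      exact absurd (hyz ▸ hmem n _) (hx n)
    · rw [hΦ z m hm hlt', hΦ0] at hyz
      exact absurd (hyz ▸ hmem m _) (hx m)
    · rfl
  · ext w
    constructor
    · rintro ⟨y, rfl⟩
      rcases hcases y with ⟨n, hn, hlt⟩ | rfl
      · rw [hΦ y n hn hlt]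
        exact Or.inr (mem_iUnion.2 ⟨n, hmem n _⟩)
      · exact Or.inl hΦ0
    · rintro (rfl | hw)
      · exact ⟨_, hΦ0⟩
      · obtain ⟨n, hw⟩ := mem_iUnion.1 hw
        obtain ⟨y, rfl⟩ := (hr n).symm ▸ hw
        refine ⟨fun k => if k < n then false else if k = n then true else y (k - (n + 1)), ?_⟩
        rw [hΦ _ n (by simp) (fun k hk => by simp [hk])]
        congr 1
        funext j
        have h1 : ¬ n + 1 + j < n := by omega
        have h2 : n + 1 + j ≠ n := by omega
        simp [h1, h2]

/-- A Cantor set splits into Cantor sets, with at most continuum many prescribed relatively open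
subsets containing distinct pieces. -/
theorem IsCantorSet.exists_partition {ι : Type*} {K : Set X} (hK : IsCantorSet K) {s : Set ι}
    (hs : #s ≤ 𝔠) {O : ι → Set X} (hO : ∀ i ∈ s, IsOpen (O i))
    (hne : ∀ i ∈ s, (O i ∩ K).Nonempty) :
    ∃ (R : Set (Set X)) (A : ι → Set X), (∀ S ∈ R, IsCantorSet S) ∧ R.PairwiseDisjoint id ∧
      ⋃₀ R = K ∧ InjOn A s ∧ ∀ i ∈ s, A i ∈ R ∧ A i ⊆ O i := by
  classical
  obtain ⟨g₀, hc₀, hi₀, rfl⟩ := hK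
  let e : CantorSpace × CantorSpace ≃ₜ CantorSpace :=
    Homeomorph.sumArrowHomeomorphProdArrow.symm.trans
      (Homeomorph.piCongrLeft (Y := fun _ => Bool) Equiv.natSumNatEquivNat)
  obtain ⟨g, hc, hi, hr⟩ : ∃ g : CantorSpace × CantorSpace → X,
      Continuous g ∧ Function.Injective g ∧ range g = range g₀ :=
    ⟨g₀ ∘ e, hc₀.comp e.continuous, hi₀.comp e.injective, e.surjective.range_comp g₀⟩
  rw [← hr] at hne ⊢
  have hloc : ∀ i : s, ∃ (a b : CantorSpace) (n : ℕ),
      PiNat.cylinder a n ×ˢ PiNat.cylinder b n ⊆ g ⁻¹' O i := by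
    rintro ⟨i, his⟩
    obtain ⟨_, hx, ⟨⟨a, b⟩, rfl⟩⟩ := hne i his
    have hnh := hc.continuousAt.preimage_mem_nhds ((hO i his).mem_nhds hx)
    rw [nhds_prod_eq, Filter.mem_prod_iff] at hnh
    obtain ⟨U, hU, V, hV, hUV⟩ := hnh
    obtain ⟨n, hn⟩ := exists_cylinder_subset hU
    obtain ⟨m, hm⟩ := exists_cylinder_subset hV
    exact ⟨a, b, max n m, (prod_mono ((PiNat.cylinder_anti a (le_max_left n m)).trans hn)
      ((PiNat.cylinder_anti b (le_max_right n m)).trans hm)).trans hUV⟩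
  choose a b n hloc using hloc
  obtain ⟨es⟩ : Nonempty (s ↪ CantorSpace) := by
    rw [← lift_mk_le']
    simpa using hs
  obtain ⟨ξ, hξ, hξb⟩ := exists_injective_mem (fun i => PiNat.cylinder (b i) (n i)) fun i =>
    (isCantorSet_cylinder (b i) (n i)).nonempty_embedding.map es.trans
  let N : CantorSpace → ℕ := Function.extend ξ n 0
  have hN : ∀ i, N (ξ i) = n i := fun i => hξ.extend_apply _ _ _
  let B : CantorSpace × CantorSpace → Set X := fun z =>
    g '' (PiNat.cylinder z.1 (N z.2) ×ˢ {z.2})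
  have hself : ∀ z, g z ∈ B z := fun z =>
    mem_image_of_mem g ⟨PiNat.self_mem_cylinder _ _, rfl⟩
  have hB : ∀ z w, g z ∈ B w → z.2 = w.2 ∧ B z = B w := by
    rintro ⟨z₁, z₂⟩ ⟨w₁, w₂⟩ ⟨u, ⟨hu₁, hu₂⟩, hu⟩
    obtain rfl := hi hu
    obtain rfl : z₂ = w₂ := hu₂
    refine ⟨rfl, ?_⟩
    simp only [B]
    rw [PiNat.mem_cylinder_iff_eq.1 hu₁]
  refine ⟨range B, fun i => if h : i ∈ s then B (a ⟨i, h⟩, ξ ⟨i, h⟩) else ∅, ?_, ?_, ?_, ?_, ?_⟩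
  · rintro _ ⟨z, rfl⟩
    have : B z = (fun y => g (y, z.2)) '' PiNat.cylinder z.1 (N z.2) := by
      simp only [B, prod_singleton, image_image]
    rw [this]
    exact (isCantorSet_cylinder _ _).image (by fun_prop) fun y y' h => congrArg Prod.fst (hi h)
  · rintro _ ⟨z, rfl⟩ _ ⟨w, rfl⟩ hzw
    refine disjoint_left.2 fun x hxz hxw => hzw ?_
    obtain ⟨u, -, rfl⟩ := id hxz
    exact (hB u z hxz).2.symm.trans (hB u w hxw).2
  · refine Subset.antisymm (sUnion_subset ?_) ?_
    · rintro _ ⟨z, rfl⟩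
      exact image_subset_range _ _
    · rintro _ ⟨z, rfl⟩
      exact ⟨B z, mem_range_self z, hself z⟩
  · intro i hi' j hj hij
    simp only [dif_pos hi', dif_pos hj] at hij
    have h1 := hself (a ⟨i, hi'⟩, ξ ⟨i, hi'⟩)
    rw [hij] at h1
    exact congrArg Subtype.val (hξ (hB _ _ h1).1)
  · intro i hi'
    simp only [dif_pos hi']
    refine ⟨mem_range_self _, ?_⟩
    simp only [B, hN]
    exact image_subset_iff.2 ((prod_mono_right (singleton_subset_iff.2 (hξb _))).trans (hloc _))

end CantorSet

section LocalCardinality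

variable {X : Type u} [TopologicalSpace X]

/-- The least cardinality of an open neighbourhood of `x`. -/
noncomputable def localCard (x : X) : Cardinal.{u} :=
  ⨅ U : {U : Set X // IsOpen U ∧ x ∈ U}, #U.1

theorem localCard_le {x : X} {U : Set X} (hU : IsOpen U) (hx : x ∈ U) : localCard x ≤ #U :=
  ciInf_le' (fun U : {U : Set X // IsOpen U ∧ x ∈ U} => #U.1) ⟨U, hU, hx⟩

theorem exists_isOpen_mk_eq_localCard (x : X) : ∃ U, IsOpen U ∧ x ∈ U ∧ #U = localCard x := by
  have : Nonempty {U : Set X // IsOpen U ∧ x ∈ U} := ⟨⟨Set.univ, isOpen_univ, mem_univ x⟩⟩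
  obtain ⟨⟨U, hU, hx⟩, h⟩ := ciInf_mem fun U : {U : Set X // IsOpen U ∧ x ∈ U} => #U.1
  exact ⟨U, hU, hx, h⟩

theorem mk_closure_le_power_aleph0 [FrechetUrysohnSpace X] [T2Space X] (S : Set X) :
    #(closure S) ≤ #S ^ ℵ₀ := by
  have h : ∀ a : closure S, ∃ y : ℕ → S, Filter.Tendsto (fun n => (y n : X)) Filter.atTop
      (nhds (a : X)) := fun a => by
    obtain ⟨y, hy, hlim⟩ := mem_closure_iff_seq_limit.1 a.2
    exact ⟨fun n => ⟨y n, hy n⟩, hlim⟩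
  choose y hy using h
  calc #(closure S) ≤ #(ℕ → S) := mk_le_of_injective (f := y) fun a b hab =>
        Subtype.ext (tendsto_nhds_unique (hy a) (hab ▸ hy b))
    _ = #S ^ ℵ₀ := by simp

theorem localCard_le_mk_inter [FrechetUrysohnSpace X] [T2Space X] (hX : #X ≤ contSuccOmega)
    {D : Set X} (hD : ∀ x U, IsOpen U → x ∈ U → 𝔠 ≤ #(U ∩ D : Set X)) {x : X} {U : Set X}
    (hU : IsOpen U) (hx : x ∈ U) : localCard x ≤ #(U ∩ D : Set X) := by
  by_contra! hlt
  have hsub : U ⊆ closure (U ∩ D) := fun y hy => mem_closure_iff.2 fun V hV hyV => by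
    have h := (continuum_pos).trans_le (hD y (U ∩ V) (hU.inter hV) ⟨hy, hyV⟩)
    obtain ⟨z, hz⟩ := nonempty_coe_sort.1 (mk_ne_zero_iff.1 h.ne')
    exact ⟨z, hz.1.2, hz.1.1, hz.2⟩
  have hlt' : #(U ∩ D : Set X) < contSuccOmega :=
    hlt.trans_le ((localCard_le hU hx).trans ((mk_set_le U).trans hX))
  have := ((localCard_le hU hx).trans (mk_le_mk_of_subset hsub)).trans
    (mk_closure_le_power_aleph0 _)
  rw [power_aleph0_eq_of_lt_contSuccOmega (hD x U hU hx) hlt'] at this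
  exact this.not_gt hlt

theorem exists_pointCountable_cover [MetrizableSpace X] (κ : Cardinal.{u}) :
    ∃ 𝒱 : Set (Set X), (∀ V ∈ 𝒱, IsOpen V ∧ #V ≤ κ) ∧
      (∀ x, localCard x ≤ κ → ∃ V ∈ 𝒱, x ∈ V) ∧ ∀ x, {V ∈ 𝒱 | x ∈ V}.Countable := by
  choose U hU hxU hcard using exists_isOpen_mk_eq_localCard (X := X)
  let O : Set X := {x | localCard x ≤ κ}
  have hO : IsOpen O := isOpen_iff_mem_nhds.2 fun x hx =>
    Filter.mem_of_superset ((hU x).mem_nhds (hxU x)) fun y hy =>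
      ((localCard_le (hU x) hy).trans (hcard x).le).trans hx
  let _ : MetricSpace O := metrizableSpaceMetric O
  obtain ⟨v, hvo, hvc, hvf, hvu⟩ := precise_refinement
    (fun x : O => ((↑) : O → X) ⁻¹' U x) (fun x => (hU x).preimage continuous_subtype_val)
    (eq_univ_of_forall fun x => mem_iUnion.2 ⟨x, hxU x⟩)
  refine ⟨range fun i => ((↑) : O → X) '' v i, ?_, ?_, ?_⟩
  · rintro _ ⟨i, rfl⟩
    refine ⟨hO.isOpenMap_subtype_val _ (hvo i), ?_⟩
    exact ((mk_le_mk_of_subset (image_subset_iff.2 (hvu i))).trans (hcard i).le).trans i.2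
  · intro x hx
    obtain ⟨i, hi⟩ := mem_iUnion.1 (hvc.symm ▸ mem_univ (⟨x, hx⟩ : O))
    exact ⟨_, ⟨i, rfl⟩, ⟨x, hx⟩, hi, rfl⟩
  · intro x
    by_cases hx : x ∈ O
    · refine ((hvf.point_finite ⟨x, hx⟩).countable.image fun i => ((↑) : O → X) '' v i).mono ?_
      rintro _ ⟨⟨i, rfl⟩, ⟨y, hy, rfl⟩⟩
      exact ⟨i, hy, rfl⟩
    · refine countable_empty.mono ?_
      rintro _ ⟨⟨i, rfl⟩, ⟨y, hy, rfl⟩⟩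
      exact hx y.2

/-- Every point of `X` selects a point of `D` from each of countably many neighbourhoods in such
a way that no point of `D` is selected uncountably often. -/
theorem exists_countable_fiber_selection [MetrizableSpace X] (hX : #X ≤ contSuccOmega)
    {D : Set X} (hD : ∀ x U, IsOpen U → x ∈ U → 𝔠 ≤ #(U ∩ D : Set X)) (W : X × ℕ → Set X)
    (hW : ∀ p, IsOpen (W p)) (hxW : ∀ p, p.1 ∈ W p) :
    ∃ d : X × ℕ → X, (∀ p, d p ∈ W p ∩ D) ∧ ∀ y, {p | d p = y}.Countable := by
  classical
  let _ : MetricSpace X := metrizableSpaceMetric X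
  have hlevel : ∀ x : X, localCard x ∈ Set.Icc 𝔠 contSuccOmega := fun x => by
    obtain ⟨U, hU, hxU, h⟩ := exists_isOpen_mk_eq_localCard x
    rw [← h]
    exact ⟨(hD x U hU hxU).trans (mk_le_mk_of_subset inter_subset_left),
      (mk_set_le U).trans hX⟩
  choose 𝒱 h𝒱 hcov hcount using exists_pointCountable_cover (X := X)
  choose v hv hxv using fun x : X => hcov (localCard x) x le_rfl
  have hsel : ∀ c : Cardinal.{u} × Set X, ∃ f : X × ℕ → X,
      InjOn f {p | (localCard p.1, v p.1) = c} ∧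
      ∀ p, (localCard p.1, v p.1) = c → f p ∈ W p ∩ v p.1 ∩ D := by
    intro c
    obtain ⟨f, hf, hfm⟩ := exists_injective_mem
      (fun p : {p : X × ℕ | (localCard p.1, v p.1) = c} => W p ∩ v p.1.1 ∩ D) fun p => by
        obtain ⟨⟨x, m⟩, rfl⟩ := p
        have hκ : ℵ₀ ≤ localCard x := aleph0_le_continuum.trans (hlevel x).1
        refine (le_def _ _).1 (le_trans ?_ (localCard_le_mk_inter hX hD
          ((hW (x, m)).inter (h𝒱 _ _ (hv x)).1) ⟨hxW (x, m), hxv x⟩))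
        have hsub : {p : X × ℕ | (localCard p.1, v p.1) = (localCard x, v x)} ⊆
            v x ×ˢ Set.univ := by
          rintro ⟨y, k⟩ hy
          obtain ⟨-, hy⟩ := Prod.mk.inj hy
          exact ⟨hy ▸ hxv y, mem_univ _⟩
        refine (mk_le_mk_of_subset hsub).trans ?_
        have hprod : #(v x ×ˢ (Set.univ : Set ℕ) : Set (X × ℕ)) = #(v x) * ℵ₀ := by
          rw [mk_congr (Equiv.Set.prod _ _)]
          simp
        rw [hprod]
        exact (mul_le_mul' (h𝒱 _ _ (hv x)).2 hκ).trans (mul_eq_self hκ).le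
    refine ⟨fun p => if h : (localCard p.1, v p.1) = c then f ⟨p, h⟩ else p.1, ?_, ?_⟩
    · intro p hp q hq hpq
      rw [mem_ofPred_eq] at hp hq
      simp only [dif_pos hp, dif_pos hq] at hpq
      exact congrArg Subtype.val (hf hpq)
    · intro p hp
      simp only [dif_pos hp]
      exact hfm ⟨p, hp⟩
  choose f hf hfm using hsel
  have hmem : ∀ p : X × ℕ, f (localCard p.1, v p.1) p ∈ W p ∩ v p.1 ∩ D := fun p => hfm _ p rfl
  refine ⟨fun p => f (localCard p.1, v p.1) p, fun p => ⟨(hmem p).1.1, (hmem p).2⟩, fun y => ?_⟩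
  have hc : (⋃ κ ∈ Set.Icc 𝔠 contSuccOmega,
      Prod.mk κ '' {V ∈ 𝒱 κ | y ∈ V} : Set (Cardinal.{u} × Set X)).Countable :=
    countable_Icc_continuum_contSuccOmega.biUnion fun κ _ => (hcount κ y).image _
  refine MapsTo.countable_of_injOn (f := fun p : X × ℕ => (localCard p.1, v p.1)) ?_ ?_ hc
  · rintro p rfl
    exact mem_biUnion (hlevel p.1) ⟨v p.1, ⟨hv p.1, (hmem p).1.2⟩, rfl⟩
  · intro p hp q hq hpq
    refine hf _ (show _ = _ from rfl) hpq.symm ?_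
    rw [mem_ofPred_eq] at hp hq
    dsimp only at hp hq hpq
    rw [hp, hpq, hq]

end LocalCardinality

theorem exists_maximal_cantor_packing (X : Type*) [TopologicalSpace X] :
    ∃ Q : Set (Set X), (∀ K ∈ Q, IsCantorSet K) ∧ Q.PairwiseDisjoint id ∧
      ∀ L, IsCantorSet L → ∃ K ∈ Q, (K ∩ L).Nonempty := by
  obtain ⟨Q, ⟨hQ, hd⟩, hmax⟩ := zorn_subset
    {Q : Set (Set X) | (∀ K ∈ Q, IsCantorSet K) ∧ Q.PairwiseDisjoint id} fun c hc hchain =>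
      ⟨⋃₀ c, ⟨fun K ⟨q, hq, hK⟩ => (hc hq).1 K hK,
        (pairwiseDisjoint_sUnion hchain.directedOn).2 fun q hq => (hc hq).2⟩,
        fun q hq => subset_sUnion_of_mem hq⟩
  refine ⟨Q, hQ, hd, fun L hL => ?_⟩
  by_contra! hcon
  have hins : insert L Q ⊆ Q := hmax ⟨?_, ?_⟩ (subset_insert _ _)
  · obtain ⟨x, hx⟩ := hL.nonempty
    exact (hcon L (hins (mem_insert _ _))).subset ⟨hx, hx⟩
  · rintro K (rfl | hK)
    exacts [hL, hQ K hK]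
  · exact hd.insert fun K hK _ => disjoint_iff_inter_eq_empty.2 ((inter_comm _ _).trans (hcon K hK))

/-- There is a packing by Cantor sets together with distinct members `A (x, 0), A (x, 1), …`,
assigned to all points `x`, that converge to `x`. -/
theorem exists_packing_with_converging_pieces {X : Type u} [MetricSpace X]
    (hX : #X ≤ contSuccOmega) (hcov : ∀ x : X, ∃ K, IsCantorSet K ∧ x ∈ K) :
    ∃ (R : Set (Set X)) (A : X × ℕ → Set X), (∀ S ∈ R, IsCantorSet S) ∧
      R.PairwiseDisjoint id ∧ Function.Injective A ∧ (∀ p, A p ∈ R) ∧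
      ∀ x n, A (x, n) ⊆ Metric.ball x (1 / (n + 1)) := by
  obtain ⟨Q, hQ, hd, hmax⟩ := exists_maximal_cantor_packing X
  have hD : ∀ x U, IsOpen U → x ∈ U → 𝔠 ≤ #(U ∩ ⋃₀ Q : Set X) := by
    intro x U hU hx
    obtain ⟨K, hK, hxK⟩ := hcov x
    obtain ⟨L, hLs, -, hL⟩ := hK.exists_subset hxK (hU.mem_nhds hx)
    obtain ⟨q, hq, y, hyq, hyL⟩ := hmax L hL
    obtain ⟨L', hLs', -, hL'⟩ := (hQ q hq).exists_subset hyq (hU.mem_nhds (hLs hyL).2)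
    rw [← hL'.mk_eq]
    exact mk_le_mk_of_subset fun z hz => ⟨(hLs' hz).2, q, hq, (hLs' hz).1⟩
  let W : X × ℕ → Set X := fun p => Metric.ball p.1 (1 / (p.2 + 1))
  obtain ⟨d, hdm, hdc⟩ := exists_countable_fiber_selection hX hD W
    (fun p => Metric.isOpen_ball) fun p => Metric.mem_ball_self (by positivity)
  have hpart : ∀ B ∈ Q, ∃ (R : Set (Set X)) (A : X × ℕ → Set X), (∀ S ∈ R, IsCantorSet S) ∧
      R.PairwiseDisjoint id ∧ ⋃₀ R = B ∧ InjOn A {p | d p ∈ B} ∧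
      ∀ p, d p ∈ B → A p ∈ R ∧ A p ⊆ W p := by
    intro B hB
    refine (hQ B hB).exists_partition ?_ (fun p _ => Metric.isOpen_ball)
      fun p hp => ⟨d p, (hdm p).1, hp⟩
    have hun : {p | d p ∈ B} = ⋃ y ∈ B, {p | d p = y} := by
      ext p; simp
    rw [hun]
    refine (mk_biUnion_le _ _).trans ?_
    rw [(hQ B hB).mk_eq]
    exact (mul_le_mul' le_rfl (ciSup_le' fun y : B => (hdc y.1).le_aleph0)).trans
      continuum_mul_aleph0.le
  choose! R A hR hRd hRB hA hAR using hpart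
  choose b hbQ hdb using fun p => (hdm p).2
  have hAb : ∀ p, A (b p) p ∈ R (b p) ∧ A (b p) p ⊆ W p := fun p =>
    hAR _ (hbQ p) p (hdb p)
  have hsub : ∀ B ∈ Q, ∀ S ∈ R B, S ⊆ B := fun B hB S hS =>
    (subset_sUnion_of_mem hS).trans (hRB B hB).le
  refine ⟨⋃ B ∈ Q, R B, fun p => A (b p) p, ?_, ?_, ?_, fun p => mem_biUnion (hbQ p) (hAb p).1,
    fun x n => (hAb (x, n)).2⟩
  · intro S hS
    obtain ⟨B, hB, hS⟩ := mem_iUnion₂.1 hS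
    exact hR B hB S hS
  · intro S hS T hT hST
    obtain ⟨B, hB, hS⟩ := mem_iUnion₂.1 hS
    obtain ⟨C, hC, hT⟩ := mem_iUnion₂.1 hT
    by_cases hBC : B = C
    · subst hBC
      exact hRd B hB hS hT hST
    · exact (hd hB hC hBC).mono (hsub B hB S hS) (hsub C hC T hT)
  · intro p q hpq
    dsimp only at hpq
    have hbb : b p = b q := by
      by_contra hne
      obtain ⟨z, hz⟩ := (hR _ (hbQ p) _ (hAb p).1).nonempty
      exact disjoint_left.1 (hd (hbQ p) (hbQ q) hne) (hsub _ (hbQ p) _ (hAb p).1 hz)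
        (hsub _ (hbQ q) _ (hAb q).1 (hpq ▸ hz))
    have hq := hdb q
    rw [← hbb] at hpq hq
    exact hA _ (hbQ p) (hdb p) hq hpq

theorem exists_cantor_partition {X : Type u} [MetricSpace X]
    (hX : #X ≤ contSuccOmega) (hcov : ∀ x : X, ∃ K, IsCantorSet K ∧ x ∈ K) :
    ∃ P : Set (Set X), (∀ K ∈ P, IsCantorSet K) ∧ P.PairwiseDisjoint id ∧ ⋃₀ P = Set.univ := by
  obtain ⟨R, A, hR, hRd, hA, hAR, hball⟩ := exists_packing_with_converging_pieces hX hcov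
  have hAd : Pairwise (Function.onFun Disjoint A) := fun p q hpq =>
    hRd (hAR p) (hAR q) (hA.ne hpq)
  let C : X → Set X := fun x => insert x (⋃ n, A (x, n))
  have hCR : ∀ x ∉ ⋃₀ R, ∀ S ∈ R, (∀ n, S ≠ A (x, n)) → Disjoint S (C x) := by
    intro x hx S hS hne
    refine disjoint_insert_right.2 ⟨fun h => hx ⟨S, hS, h⟩, disjoint_iUnion_right.2 fun n => ?_⟩
    exact hRd hS (hAR _) (hne n)
  refine ⟨(R \ A '' {p | p.1 ∉ ⋃₀ R}) ∪ C '' (⋃₀ R)ᶜ, ?_, ?_, ?_⟩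
  · rintro K (⟨hK, -⟩ | ⟨x, hx, rfl⟩)
    · exact hR K hK
    · refine isCantorSet_insert_iUnion (fun n => hR _ (hAR _))
        (fun n m hnm => hAd fun h => hnm (congrArg Prod.snd h))
        (fun n h => hx ⟨_, hAR _, h⟩) fun U hU => ?_
      obtain ⟨ε, hε, hU⟩ := Metric.mem_nhds_iff.1 hU
      obtain ⟨N, hN⟩ := exists_nat_one_div_lt hε
      filter_upwards [Filter.eventually_ge_atTop N] with n hn
      exact (hball x n).trans ((Metric.ball_subset_ball
        ((Nat.one_div_le_one_div hn).trans hN.le)).trans hU)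
  · have hne : ∀ S ∈ R \ A '' {p | p.1 ∉ ⋃₀ R}, ∀ x ∈ (⋃₀ R)ᶜ, Disjoint S (C x) :=
      fun S hS x hx => hCR x hx S hS.1 fun n h => hS.2 ⟨(x, n), hx, h.symm⟩
    rintro S (hS | ⟨x, hx, rfl⟩) T (hT | ⟨y, hy, rfl⟩) hST
    · exact hRd hS.1 hT.1 hST
    · exact hne S hS y hy
    · exact (hne T hT x hx).symm
    · have hxy : x ≠ y := fun h => hST (h ▸ rfl)
      refine disjoint_insert_left.2 ⟨?_, disjoint_iUnion_left.2 fun n =>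
        hCR y hy _ (hAR _) fun m h => hxy (congrArg Prod.fst (hA h))⟩
      rintro (h | h)
      · exact hxy h
      · obtain ⟨n, hn⟩ := mem_iUnion.1 h
        exact hx ⟨_, hAR _, hn⟩
  · refine eq_univ_of_forall fun y => ?_
    by_cases hy : y ∈ ⋃₀ R
    · obtain ⟨S, hS, hyS⟩ := hy
      by_cases hSA : S ∈ A '' {p | p.1 ∉ ⋃₀ R}
      · obtain ⟨⟨x, n⟩, hx, rfl⟩ := hSA
        exact ⟨C x, Or.inr ⟨x, hx, rfl⟩, Or.inr (mem_iUnion.2 ⟨n, hyS⟩)⟩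
      · exact ⟨S, Or.inl ⟨hS, hSA⟩, hyS⟩
    · exact ⟨C y, Or.inr ⟨y, hy, rfl⟩, mem_insert _ _⟩

theorem stmt_9 {X : Type u} [TopologicalSpace X] [MetrizableSpace X]
    (hX : Cardinal.mk X ≤ contSuccOmega) :
    Partitionable X CantorSpace ↔ Coverable X CantorSpace := by
  constructor
  · rintro ⟨P, hP, -, hU⟩
    exact ⟨P, hP, hU⟩
  · rintro ⟨C, hC, hU⟩
    let _ : MetricSpace X := metrizableSpaceMetric X
    obtain ⟨P, hP, hd, hPU⟩ := exists_cantor_partition hX fun x => by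
      obtain ⟨K, hK, hx⟩ := hU.symm ▸ mem_univ x
      exact ⟨K, isCantorSet_iff_nonempty_homeomorph.2 (hC K hK), hx⟩
    exact ⟨P, fun K hK => isCantorSet_iff_nonempty_homeomorph.1 (hP K hK), hd, hPU⟩
end

section
/- There is a metrizable space X with |X| = 𝔠^{+(ω+1)} (the cardinal successor of the least limit cardinal above 𝔠) such that X is 2^ω-coverable but X is not 2^ω-partitionable. -/
open Cardinal Set TopologicalSpace

open MeasureTheory Filter Order

/-- An atomless σ-finite measure space cannot be well-ordered by a measurable relation. -/
theorem not_measurableSet_setOf_lt {Ω α : Type*} [MeasurableSpace Ω] [MeasurableSingletonClass Ω]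
    (μ : Measure Ω) [SigmaFinite μ] [NullSingletonClass μ] (hμ : μ ≠ 0)
    [LinearOrder α] [WellFoundedLT α] (φ : Ω → α) (hφ : Function.Injective φ) :
    ¬ MeasurableSet {p : Ω × Ω | φ p.1 < φ p.2} := by
  intro hR
  obtain ⟨S, hS0, hS⟩ : ∃ S : Set Ω, μ S ≠ 0 ∧ ∀ z ∈ S, μ {x | φ x < φ z} = 0 := by
    by_cases h : ∃ y, μ {x | φ x < φ y} ≠ 0
    · obtain ⟨y, hy, hmin⟩ := (InvImage.wf φ (wellFounded_lt (α := α))).has_min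
        {y | μ {x | φ x < φ y} ≠ 0} h
      refine ⟨_, hy, fun z hz => ?_⟩
      by_contra hne
      exact hmin z hne hz
    · push Not at h
      exact ⟨Set.univ, by simpa using hμ, fun z _ => h z⟩
  set G := {z | μ {x | φ x < φ z} = 0}
  have hGm : MeasurableSet G :=
    measurable_measure_prodMk_right (μ := μ) hR (measurableSet_singleton 0)
  set ν := μ.restrict G
  have hν0 : ν ≠ 0 := by
    intro h
    exact hS0 (measure_mono_null hS (Measure.restrict_eq_zero.1 h))
  have hlow : ∀ᵐ z ∂ν, ν {x | φ x < φ z} = 0 := by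
    filter_upwards [ae_restrict_mem hGm] with z hz
    exact Measure.absolutelyContinuous_of_le Measure.restrict_le_self hz
  have hnull : (ν.prod ν) {p : Ω × Ω | φ p.1 < φ p.2} = 0 := by
    rw [Measure.prod_apply_symm hR]
    exact (lintegral_eq_zero_iff (measurable_measure_prodMk_right hR)).2 hlow
  have hup := Measure.measure_ae_null_of_prod_null hnull
  have : NeBot (ae ν) := ae_neBot.2 hν0
  obtain ⟨x, hx1, hx2⟩ := (hup.and hlow).exists
  apply hν0
  rw [← Measure.measure_univ_eq_zero]
  have hcov : (Set.univ : Set Ω) ⊆ {z | φ x < φ z} ∪ ({z | φ z < φ x} ∪ {x}) := by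
    intro z _
    rcases lt_trichotomy (φ x) (φ z) with h | h | h
    · exact Or.inl h
    · exact Or.inr (Or.inr (hφ h).symm)
    · exact Or.inr (Or.inl h)
  refine measure_mono_null hcov (measure_union_null hx1 (measure_union_null hx2 ?_))
  simp

/-- The Cantor space cannot be well-ordered by a measurable relation. -/
theorem not_measurableSet_setOf_lt_cantorSpace {α : Type*} [LinearOrder α] [WellFoundedLT α]
    (φ : CantorSpace → α) (hφ : Function.Injective φ) :
    ¬ MeasurableSet {p : CantorSpace × CantorSpace | φ p.1 < φ p.2} := by
  intro hR
  have h1 : ¬ Countable ℝ := not_countable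
  have h2 : ¬ Countable CantorSpace := by
    rw [← Cardinal.mk_le_aleph0_iff]
    simp [Cardinal.aleph0_lt_continuum]
  let e : ℝ ≃ᵐ CantorSpace := PolishSpace.measurableEquivOfNotCountable h1 h2
  exact not_measurableSet_setOf_lt (volume : Measure ℝ) (NeZero.ne _) (φ ∘ e)
    (hφ.comp e.injective)
    (((e.measurable.comp measurable_fst).prodMk (e.measurable.comp measurable_snd)) hR)

/-- The regular cardinals `𝔠⁺, 𝔠⁺⁺, …` cofinal in `𝔠^{+ω}`. -/
noncomputable def contSucc (n : ℕ) : Cardinal.{0} := Order.succ^[n + 1] Cardinal.continuum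

theorem contSucc_succ (n : ℕ) : contSucc (n + 1) = Order.succ (contSucc n) :=
  Function.iterate_succ_apply' _ _ _

theorem continuum_lt_contSucc (n : ℕ) : Cardinal.continuum < contSucc n := by
  induction n with
  | zero => exact Order.lt_succ _
  | succ n ih => rw [contSucc_succ]; exact ih.trans (Order.lt_succ _)

theorem contSucc_strictMono : StrictMono contSucc :=
  strictMono_nat_of_lt_succ fun n => by rw [contSucc_succ]; exact Order.lt_succ _

theorem aleph0_le_contSucc (n : ℕ) : Cardinal.aleph0 ≤ contSucc n :=
  Cardinal.aleph0_le_continuum.trans (continuum_lt_contSucc n).le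

theorem isRegular_contSucc (n : ℕ) : (contSucc n).IsRegular := by
  cases n with
  | zero => exact Cardinal.isRegular_succ Cardinal.aleph0_le_continuum
  | succ n => rw [contSucc_succ]; exact Cardinal.isRegular_succ (aleph0_le_contSucc n)

theorem contSucc_le_contSuccOmega (n : ℕ) : contSucc n ≤ contSuccOmega :=
  le_ciSup (f := fun n : ℕ => Order.succ^[n] Cardinal.continuum)
    (Cardinal.bddAbove_of_small) (n + 1)

theorem continuum_le_contSuccOmega : Cardinal.continuum ≤ contSuccOmega.{0} :=
  (continuum_lt_contSucc 0).le.trans (contSucc_le_contSuccOmega 0)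

theorem aleph0_le_contSuccOmega : Cardinal.aleph0 ≤ contSuccOmega.{0} :=
  Cardinal.aleph0_le_continuum.trans continuum_le_contSuccOmega

/-- The initial ordinal of `contSucc n`, as a discrete space. -/
def Rung (n : ℕ) : Type := (contSucc n).ord.ToType

namespace Rung

noncomputable instance (n : ℕ) : LinearOrder (Rung n) :=
  inferInstanceAs (LinearOrder (contSucc n).ord.ToType)

instance (n : ℕ) : WellFoundedLT (Rung n) :=
  inferInstanceAs (WellFoundedLT (contSucc n).ord.ToType)

instance (n : ℕ) : TopologicalSpace (Rung n) := ⊥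

instance (n : ℕ) : DiscreteTopology (Rung n) := ⟨rfl⟩

theorem mk_eq (n : ℕ) : Cardinal.mk (Rung n) = contSucc n := Cardinal.mk_ord_toType _

noncomputable instance (n : ℕ) : Inhabited (Rung n) :=
  Classical.inhabited_of_nonempty <| Cardinal.mk_ne_zero_iff.1 <| by
    rw [mk_eq]; exact (isRegular_contSucc n).ne_zero

theorem exists_forall_lt {n : ℕ} (s : Set (Rung n)) (hs : Cardinal.mk s < contSucc n) :
    ∃ b, ∀ a ∈ s, a < b := by
  rw [← not_isCofinal_iff]
  intro h
  have h1 := Order.cof_le h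
  have h2 : Order.cof (Rung n) = contSucc n :=
    (Ordinal.cof_toType _).trans (isRegular_contSucc n).cof_ord
  exact absurd (h2 ▸ h1) hs.not_ge

theorem mk_sigma : Cardinal.mk (Σ n, Rung n) = contSuccOmega := by
  apply le_antisymm
  · rw [Cardinal.mk_sigma]
    refine (Cardinal.sum_le_mk_mul_iSup _).trans ?_
    refine (mul_le_mul' (Cardinal.mk_le_aleph0.trans aleph0_le_contSuccOmega)
      (ciSup_le' fun n => (mk_eq n).trans_le (contSucc_le_contSuccOmega n))).trans ?_
    rw [Cardinal.mul_eq_self aleph0_le_contSuccOmega]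
  · refine ciSup_le' fun n => ?_
    calc Order.succ^[n] Cardinal.continuum ≤ contSucc n := by
          rw [contSucc, Function.iterate_succ_apply']; exact Order.le_succ _
      _ = Cardinal.mk (Rung n) := (mk_eq n).symm
      _ ≤ _ := Cardinal.mk_le_of_injective (f := Sigma.mk n) sigma_mk_injective

/-- A family of at most `𝔠^{+ω}` functions has a strict upper bound modulo finite sets. -/
theorem exists_eventually_lt {ι : Type} (hι : Cardinal.mk ι ≤ contSuccOmega)
    (f : ι → ∀ n, Rung n) : ∃ g : ∀ n, Rung n, ∀ i, ∀ᶠ n in atTop, f i n < g n := by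
  rw [← mk_sigma] at hι
  obtain ⟨h⟩ := hι
  have key : ∀ n, ∃ b : Rung n, ∀ a ∈ (fun i => f i n) '' {i | (h i).1 < n}, a < b := by
    intro n
    apply exists_forall_lt
    refine Cardinal.mk_image_le.trans_lt ?_
    have hinj : Function.Injective (fun i : {i | (h i).1 < n} =>
        (⟨⟨(h i).1, i.2⟩, (h i).2⟩ : Σ m : Fin n, Rung m)) := by
      rintro ⟨i, hi⟩ ⟨j, hj⟩ hij
      apply Subtype.ext
      apply h.injective
      have := congrArg (fun p : Σ m : Fin n, Rung m => (⟨p.1, p.2⟩ : Σ m, Rung m)) hij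
      exact this
    refine (Cardinal.mk_le_of_injective hinj).trans_lt ?_
    rw [Cardinal.mk_sigma]
    refine Cardinal.sum_lt_of_isRegular (isRegular_contSucc n) ?_ fun m => ?_
    · exact (Cardinal.mk_lt_aleph0).trans_le (aleph0_le_contSucc n)
    · rw [mk_eq]; exact contSucc_strictMono m.2
  choose g hg using key
  refine ⟨g, fun i => ?_⟩
  filter_upwards [eventually_gt_atTop (h i).1] with n hn
  exact hg n _ ⟨i, hn, rfl⟩

/-- The index set of a scale in `∀ n, Rung n`. -/
abbrev ScaleIndex : Type := (Order.succ contSuccOmega.{0}).ord.ToType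

theorem exists_scale : ∃ f : ScaleIndex → ∀ n, Rung n,
    ∀ i j, i < j → ∀ᶠ n in atTop, f i n < f j n := by
  have key : ∀ (j : ScaleIndex) (f : Set.Iio j → ∀ n, Rung n),
      ∃ g : ∀ n, Rung n, ∀ i, ∀ᶠ n in atTop, f i n < g n := fun j f =>
    exists_eventually_lt (Order.lt_succ_iff.1 ((Cardinal.mk_Iio_lt j (by simp)).trans_eq
      (Cardinal.mk_ord_toType _))) f
  choose G hG using key
  let f : ScaleIndex → ∀ n, Rung n := (wellFounded_lt (α := ScaleIndex)).fix
    fun j ih => G j fun i => ih i.1 i.2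
  refine ⟨f, fun i j hij => ?_⟩
  have hf : f j = G j fun i => f i.1 := WellFounded.fix_eq _ _ _
  rw [hf]
  exact hG j (fun i => f i.1) ⟨i, hij⟩

theorem scale_lt_iff {f : ScaleIndex → ∀ n, Rung n}
    (hf : ∀ i j, i < j → ∀ᶠ n in atTop, f i n < f j n) (i j : ScaleIndex) :
    i < j ↔ ∀ᶠ n in atTop, f i n < f j n := by
  refine ⟨hf i j, fun h => ?_⟩
  by_contra hij
  rcases (not_lt.1 hij).eq_or_lt with rfl | hji
  · obtain ⟨n, hn⟩ := h.exists
    exact lt_irrefl _ hn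
  · obtain ⟨n, hn, hn'⟩ := (h.and (hf j i hji)).exists
    exact lt_asymm hn hn'

theorem scale_injective {f : ScaleIndex → ∀ n, Rung n}
    (hf : ∀ i j, i < j → ∀ᶠ n in atTop, f i n < f j n) : Function.Injective f := by
  intro i j hij
  by_contra hne
  rcases lt_or_gt_of_ne hne with h | h <;>
  · obtain ⟨n, hn⟩ := (hf _ _ h).exists
    simp [hij] at hn

/-- A scale contains no copy of the Cantor space. -/
theorem not_range_subset_scale {f : ScaleIndex → ∀ n, Rung n}
    (hf : ∀ i j, i < j → ∀ᶠ n in atTop, f i n < f j n)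
    {ψ : CantorSpace → ∀ n, Rung n} (hψ : Continuous ψ) (hinj : Function.Injective ψ) :
    ¬ Set.range ψ ⊆ Set.range f := by
  intro hsub
  choose φ hφ using fun x => hsub ⟨x, rfl⟩
  refine not_measurableSet_setOf_lt_cantorSpace φ (fun x y h => hinj ?_) ?_
  · rw [← hφ x, ← hφ y, h]
  · simp_rw [scale_lt_iff hf, hφ]
    have : {p : CantorSpace × CantorSpace | ∀ᶠ n in atTop, ψ p.1 n < ψ p.2 n} =
        ⋃ N, ⋂ n, ⋂ (_ : N ≤ n), {p | ψ p.1 n < ψ p.2 n} := by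
      ext p; simp [eventually_atTop]
    rw [this]
    refine .iUnion fun N => .iInter fun n => .iInter fun _ => IsOpen.measurableSet ?_
    have hc : Continuous fun p : CantorSpace × CantorSpace => (ψ p.1 n, ψ p.2 n) := by fun_prop
    exact (isOpen_discrete {q : Rung n × Rung n | q.1 < q.2}).preimage hc

/-- The sequences that are eventually equal to the base point. -/
def eventuallyDefault : Set (∀ n, Rung n) := {u | ∀ᶠ n in atTop, u n = default}

theorem mk_eventuallyDefault_le : Cardinal.mk eventuallyDefault ≤ contSuccOmega := by
  have hfin : ∀ u : eventuallyDefault, {n | u.1 n ≠ default}.Finite := fun u => by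
    have h : ∀ᶠ n in atTop, u.1 n = default := u.2
    rw [← Nat.cofinite_eq_atTop] at h
    exact h
  have hinj : Function.Injective (fun u : eventuallyDefault =>
      (hfin u).toFinset.image fun n => (⟨n, u.1 n⟩ : Σ n, Rung n)) := by
    intro u v huv
    have hmem : ∀ u v : eventuallyDefault,
        (hfin u).toFinset.image (fun n => (⟨n, u.1 n⟩ : Σ n, Rung n)) =
          (hfin v).toFinset.image (fun n => (⟨n, v.1 n⟩ : Σ n, Rung n)) →
        ∀ n, u.1 n ≠ default → v.1 n = u.1 n := by
      intro u v huv n hn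
      have h1 : (⟨n, u.1 n⟩ : Σ n, Rung n) ∈
          (hfin u).toFinset.image (fun n => (⟨n, u.1 n⟩ : Σ n, Rung n)) :=
        Finset.mem_image.2 ⟨n, by simpa using hn, rfl⟩
      rw [huv] at h1
      obtain ⟨m, -, hm⟩ := Finset.mem_image.1 h1
      obtain ⟨rfl, h⟩ := Sigma.mk.inj_iff.1 hm
      exact eq_of_heq h
    apply Subtype.ext
    funext n
    by_cases hu : u.1 n = default
    · by_cases hv : v.1 n = default
      · rw [hu, hv]
      · exact hmem v u huv.symm n hv
    · exact (hmem u v huv n hu).symm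
  refine (Cardinal.mk_le_of_injective hinj).trans ?_
  have : Infinite (Σ n, Rung n) := by
    rw [Cardinal.infinite_iff, mk_sigma]; exact aleph0_le_contSuccOmega
  rw [Cardinal.mk_finset_of_infinite, mk_sigma]

end Rung

open Rung

/-- The range of a continuous injection of the Cantor space into a Hausdorff space. -/
theorem nonempty_range_homeomorph_cantorSpace {X : Type*} [TopologicalSpace X] [T2Space X]
    {g : CantorSpace → X} (hg : Continuous g) (hinj : Function.Injective g) :
    Nonempty (Set.range g ≃ₜ CantorSpace) :=
  ⟨(hg.isClosedEmbedding hinj).isEmbedding.toHomeomorph.symm⟩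

/-- The sequence equal to `a` as long as `x` vanishes, and to the base point afterwards. -/
noncomputable def truncate (a : ∀ n, Rung n) (x : CantorSpace) (n : ℕ) : Rung n :=
  if ∀ i : Fin (n + 1), x i = false then a n else default

theorem continuous_truncate (a : ∀ n, Rung n) : Continuous (truncate a) := by
  refine continuous_pi fun n => ?_
  have h1 : Continuous fun (x : CantorSpace) (i : Fin (n + 1)) => x i := by fun_prop
  exact (continuous_of_discreteTopology (f := fun y : Fin (n + 1) → Bool =>
    if ∀ i, y i = false then a n else (default : Rung n))).comp h1

theorem truncate_zero (a : ∀ n, Rung n) : truncate a (fun _ => false) = a := by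
  funext n; simp [truncate]

theorem truncate_mem (a : ∀ n, Rung n) {x : CantorSpace} (hx : x ≠ fun _ => false) :
    truncate a x ∈ eventuallyDefault := by
  obtain ⟨i, hi⟩ := Function.ne_iff.1 hx
  filter_upwards [eventually_ge_atTop i] with n hn
  exact if_neg fun h => hi (h ⟨i, Nat.lt_succ_of_le hn⟩)

/-- The space `(eventuallyDefault × 2^ω) ∪ (A × {0})`. -/
def hedgehog (A : Set (∀ n, Rung n)) : Set ((∀ n, Rung n) × CantorSpace) :=
  {p | p.1 ∈ eventuallyDefault ∨ (p.1 ∈ A ∧ p.2 = fun _ => false)}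

theorem coverable_hedgehog (A : Set (∀ n, Rung n)) : Coverable (hedgehog A) CantorSpace := by
  refine ⟨{K | Nonempty (K ≃ₜ CantorSpace)}, fun K hK => hK, ?_⟩
  refine Set.eq_univ_of_forall fun p => ?_
  obtain ⟨⟨u, x⟩, hp⟩ := p
  rcases id hp with hu | ⟨hu, hx⟩
  · let g : CantorSpace → hedgehog A := fun y => ⟨(u, y), Or.inl hu⟩
    have hg : Continuous g := by fun_prop
    have hinj : Function.Injective g := fun y z h => congrArg (fun p => p.1.2) h
    exact ⟨Set.range g, nonempty_range_homeomorph_cantorSpace hg hinj, x, rfl⟩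
  · have hmem : ∀ y, (truncate u y, y) ∈ hedgehog A := by
      intro y
      by_cases hy : y = fun _ => false
      · subst hy
        exact Or.inr ⟨by rwa [truncate_zero], rfl⟩
      · exact Or.inl (truncate_mem u hy)
    let g : CantorSpace → hedgehog A := fun y => ⟨(truncate u y, y), hmem y⟩
    have hg : Continuous g := ((continuous_truncate u).prodMk continuous_id).subtype_mk _
    have hinj : Function.Injective g := fun y z h => congrArg (fun p => p.1.2) h
    refine ⟨Set.range g, nonempty_range_homeomorph_cantorSpace hg hinj, x, ?_⟩
    apply Subtype.ext
    have hx' : x = fun _ => false := hx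
    subst hx'
    exact Prod.ext (truncate_zero u) rfl

theorem mk_eventuallyDefault_prod_le :
    Cardinal.mk (eventuallyDefault ×ˢ (Set.univ : Set CantorSpace) : Set _) ≤ contSuccOmega := by
  rw [Cardinal.mk_setProd, Cardinal.mk_univ]
  refine (mul_le_mul' (by simpa using mk_eventuallyDefault_le)
    (by simpa using continuum_le_contSuccOmega)).trans ?_
  rw [Cardinal.mul_eq_self aleph0_le_contSuccOmega]

theorem mk_hedgehog {f : ScaleIndex → ∀ n, Rung n} (hf : Function.Injective f) :
    Cardinal.mk (hedgehog (Set.range f)) = Order.succ contSuccOmega := by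
  apply le_antisymm
  · have hsub : hedgehog (Set.range f) ⊆ (eventuallyDefault ×ˢ (Set.univ : Set CantorSpace)) ∪
        Set.range fun i => (f i, fun _ => false) := by
      rintro ⟨u, x⟩ (h | ⟨⟨i, hi⟩, hx⟩)
      · exact Or.inl ⟨h, trivial⟩
      · exact Or.inr ⟨i, Prod.ext hi hx.symm⟩
    refine (Cardinal.mk_le_mk_of_subset hsub).trans ((Cardinal.mk_union_le _ _).trans ?_)
    refine Cardinal.add_le_of_le (aleph0_le_contSuccOmega.trans (Order.le_succ _))
      (mk_eventuallyDefault_prod_le.trans (Order.le_succ _)) ?_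
    exact Cardinal.mk_range_le.trans (Cardinal.mk_ord_toType _).le
  · rw [← Cardinal.mk_ord_toType (Order.succ contSuccOmega)]
    refine Cardinal.mk_le_of_injective
      (f := fun i : ScaleIndex => (⟨(f i, fun _ => false), Or.inr ⟨⟨i, rfl⟩, rfl⟩⟩ :
        hedgehog (Set.range f))) fun i j h => hf (congrArg (fun p => p.1.1) h)

theorem exists_mem_eventuallyDefault {f : ScaleIndex → ∀ n, Rung n}
    (hf : ∀ i j, i < j → ∀ᶠ n in atTop, f i n < f j n)
    {K : Set (hedgehog (Set.range f))} (hK : Nonempty (K ≃ₜ CantorSpace)) :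
    ∃ p ∈ K, p.1.1 ∈ eventuallyDefault := by
  obtain ⟨e⟩ := hK
  by_contra! hcon
  have hA : ∀ x, (e.symm x).1.1.1 ∈ Set.range f ∧ (e.symm x).1.1.2 = fun _ => false := fun x =>
    (e.symm x).1.2.resolve_left (hcon _ (e.symm x).2)
  refine not_range_subset_scale hf (ψ := fun x => (e.symm x).1.1.1) ?_ ?_ ?_
  · exact continuous_fst.comp
      (continuous_subtype_val.comp (continuous_subtype_val.comp e.symm.continuous))
  · intro x y h
    apply e.symm.injective
    apply Subtype.ext
    apply Subtype.ext
    exact Prod.ext h ((hA x).2.trans (hA y).2.symm)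
  · rintro _ ⟨x, rfl⟩
    exact (hA x).1

theorem not_partitionable_hedgehog {f : ScaleIndex → ∀ n, Rung n}
    (hf : ∀ i j, i < j → ∀ᶠ n in atTop, f i n < f j n) :
    ¬ Partitionable (hedgehog (Set.range f)) CantorSpace := by
  rintro ⟨P, hP, hdisj, hcov⟩
  choose b hbK hb using fun K : P => exists_mem_eventuallyDefault hf (hP K K.2)
  have hcard : Cardinal.mk P ≤ contSuccOmega := by
    refine le_trans (Cardinal.mk_le_of_injective (f := fun K : P =>
      (⟨(b K).1, hb K, trivial⟩ : (eventuallyDefault ×ˢ (Set.univ : Set CantorSpace) : Set _)))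
      fun K L h => ?_) mk_eventuallyDefault_prod_le
    have hKL : b K = b L := Subtype.ext (Subtype.mk.inj h)
    by_contra hne
    exact Set.disjoint_left.1 (hdisj K.2 L.2 fun h => hne (Subtype.ext h)) (hbK K)
      (hKL ▸ hbK L)
  have hle : Cardinal.mk (hedgehog (Set.range f)) ≤ contSuccOmega := by
    rw [← Cardinal.mk_univ, ← hcov]
    refine (Cardinal.mk_sUnion_le P).trans ((mul_le_mul' hcard (ciSup_le' fun K => ?_)).trans
      (Cardinal.mul_eq_self aleph0_le_contSuccOmega).le)
    obtain ⟨e⟩ := hP K K.2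
    rw [Cardinal.mk_congr e.toEquiv]
    simpa using continuum_le_contSuccOmega
  rw [mk_hedgehog (scale_injective hf)] at hle
  exact (Order.lt_succ _).not_ge hle

theorem stmt_12 :
    ∃ (X : Type) (t : TopologicalSpace X),
      @MetrizableSpace X t ∧
      Cardinal.mk X = Order.succ contSuccOmega ∧
      @Coverable X CantorSpace t _ ∧ ¬ @Partitionable X CantorSpace t _ := by
  obtain ⟨f, hf⟩ := exists_scale
  exact ⟨hedgehog (Set.range f), inferInstance, inferInstance, mk_hedgehog (scale_injective hf),
    coverable_hedgehog _, not_partitionable_hedgehog hf⟩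
end
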